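/- Let 1 ≤ q < ∞, −1/q ≤ λ < 0, 1 < q_j < ∞ with 1/q = 1/q_1 + ⋯ + 1/q_m, γ = γ_1 + ⋯ + γ_m, α ∈ ℝ with α ≠ −Q, and −1/q_j < λ_j < 0 with qλ = q_jλ_j for j = 1,…,m. Set B_m = ∫_{(ℝ^{2n+1})^m} ∏_{j=1}^m |y_j|_h^{Qλ_j − γ_j/q + α(λ_j + 1/q_j)} / (1 + |y_1|_h^Q + ⋯ + |y_m|_h^Q)^m dy_1⋯dy_m and assume B_m < ∞. Then the least constant C such that ‖P^{h*}_m(f_1,…,f_m)‖_{L^{q,λ}(ℍⁿ,|x|_h^α,|x|_h^γ)} ≤ C·∏_{j=1}^m ‖f_j‖_{L^{q_j,λ_j}(ℍⁿ,|x|_h^α,|x|_h^{q_jγ_j/q})} holds for all nonnegative radial f_j ∈ L^{q_j,λ_j}(ℍⁿ,|x|_h^α,|x|_h^{q_jγ_j/q}) is exactly B_m. -/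

import Mathlib

open MeasureTheory Real ENNReal Finset

noncomputable section

/-- Korányi norm on ℝ^{2n+1}. -/
def knorm (n : ℕ) (x : Fin (2*n+1) → ℝ) : ℝ :=
  ((∑ i : Fin (2*n), x (Fin.castSucc i) ^ 2) ^ 2 + x (Fin.last (2*n)) ^ 2) ^ ((1:ℝ)/4)

/-- homogeneous dimension Q = 2n+2, as a real number -/
def Qr (n : ℕ) : ℝ := 2 * n + 2

/-- volume of the unit Korányi ball -/
def OmegaQ (n : ℕ) : ℝ :=
  2 * Real.pi ^ ((n : ℝ) + 1/2) * Real.Gamma ((n : ℝ)/2) /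
    ((n + 1) * Real.Gamma (n : ℝ) * Real.Gamma (((n : ℝ) + 1)/2))

def omegaQ (n : ℕ) : ℝ := Qr n * OmegaQ n

/-- Heisenberg group law on ℝ^{2n+1}. -/
def hmul (n : ℕ) (x y : Fin (2*n+1) → ℝ) : Fin (2*n+1) → ℝ := fun i =>
  if (i : ℕ) < 2*n then x i + y i
  else x i + y i + 2 * ∑ j : Fin n,
      (y ⟨j, by have := j.isLt; omega⟩ * x ⟨n + j, by have := j.isLt; omega⟩
        - x ⟨j, by have := j.isLt; omega⟩ * y ⟨n + j, by have := j.isLt; omega⟩)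

/-- Heisenberg dilation δ_r. -/
def hdil (n : ℕ) (r : ℝ) (x : Fin (2*n+1) → ℝ) : Fin (2*n+1) → ℝ :=
  fun i => if (i : ℕ) < 2*n then r * x i else r^2 * x i

/-- left-invariant distance d(p,q) = |q⁻¹ ∘ p|_h -/
def hdist (n : ℕ) (p q : Fin (2*n+1) → ℝ) : ℝ := knorm n (hmul n (fun i => - q i) p)

/-- Korányi ball B(a,R) -/
def hball (n : ℕ) (a : Fin (2*n+1) → ℝ) (R : ℝ) : Set (Fin (2*n+1) → ℝ) :=
  {y | hdist n a y < R}

/-- two power weighted Morrey norm on the Heisenberg group -/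
def morreyNorm (n : ℕ) (q lam al ga : ℝ) (f : (Fin (2*n+1) → ℝ) → ℝ) : ℝ≥0∞ :=
  ⨆ (a : Fin (2*n+1) → ℝ) (R : ℝ) (_ : 0 < R),
    (∫⁻ x in hball n a R, ENNReal.ofReal (knorm n x ^ al)) ^ (-(lam + 1/q)) *
    (∫⁻ x in hball n a R, ENNReal.ofReal (|f x| ^ q * knorm n x ^ ga)) ^ (1/q)

/-- m-linear Hardy–Littlewood–Pólya operator -/
def hlpOp (n m : ℕ) (f : Fin m → (Fin (2*n+1) → ℝ) → ℝ) (x : Fin (2*n+1) → ℝ) : ℝ :=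
  ∫ y : Fin m → Fin (2*n+1) → ℝ,
    (∏ j, f j (y j)) /
      (Finset.univ.fold max (knorm n x ^ Qr n) (fun j => knorm n (y j) ^ Qr n)) ^ m

/-- m-linear Hilbert operator -/
def hilbOp (n m : ℕ) (f : Fin m → (Fin (2*n+1) → ℝ) → ℝ) (x : Fin (2*n+1) → ℝ) : ℝ :=
  ∫ y : Fin m → Fin (2*n+1) → ℝ,
    (∏ j, f j (y j)) / (knorm n x ^ Qr n + ∑ j, knorm n (y j) ^ Qr n) ^ m

/-- the constant A_m -/
def Aconst (n m : ℕ) (e : Fin m → ℝ) : ℝ≥0∞ :=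
  ∫⁻ y : Fin m → Fin (2*n+1) → ℝ,
    ENNReal.ofReal ((∏ j, knorm n (y j) ^ e j) /
      (Finset.univ.fold max (1:ℝ) (fun j => knorm n (y j) ^ Qr n)) ^ m)

/-- the constant B_m -/
def Bconst (n m : ℕ) (e : Fin m → ℝ) : ℝ≥0∞ :=
  ∫⁻ y : Fin m → Fin (2*n+1) → ℝ,
    ENNReal.ofReal ((∏ j, knorm n (y j) ^ e j) /
      (1 + ∑ j, knorm n (y j) ^ Qr n) ^ m)

abbrev HX (n : ℕ) := Fin (2*n+1) → ℝ

lemma knorm_nonneg (n : ℕ) (x : HX n) : 0 ≤ knorm n x := by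
  unfold knorm; positivity

lemma continuous_knorm (n : ℕ) : Continuous (knorm n) := by
  unfold knorm
  refine Continuous.rpow_const (by fun_prop) ?_
  intro x; right; norm_num

lemma measurable_knorm (n : ℕ) : Measurable (knorm n) := (continuous_knorm n).measurable

lemma knorm_pow4 (n : ℕ) (x : HX n) : knorm n x ^ 4 =
    (∑ i : Fin (2*n), x (Fin.castSucc i) ^ 2) ^ 2 + x (Fin.last (2*n)) ^ 2 := by
  unfold knorm
  rw [← Real.rpow_natCast, ← Real.rpow_mul (by positivity)]
  norm_num

lemma abs_le_knorm (n : ℕ) (x : HX n) (i : Fin (2*n)) : |x i.castSucc| ≤ knorm n x := by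
  have h := knorm_pow4 n x
  have h1 : x i.castSucc ^ 2 ≤ ∑ i : Fin (2*n), x (Fin.castSucc i) ^ 2 :=
    Finset.single_le_sum (f := fun i : Fin (2*n) => x (Fin.castSucc i) ^ 2)
      (fun _ _ => sq_nonneg _) (Finset.mem_univ i)
  refine le_of_pow_le_pow_left₀ (n := 4) (by norm_num) (knorm_nonneg n x) ?_
  rw [h]
  have h2 : |x i.castSucc| ^ 4 = (x i.castSucc ^ 2) ^ 2 := by
    rw [← sq_abs (x i.castSucc)]; ring
  rw [h2]
  have := pow_le_pow_left₀ (sq_nonneg _) h1 2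
  nlinarith [sq_nonneg (x (Fin.last (2*n)))]

lemma abs_last_le_knorm (n : ℕ) (x : HX n) : |x (Fin.last (2*n))| ≤ knorm n x ^ 2 := by
  have h := knorm_pow4 n x
  refine abs_le_of_sq_le_sq ?_ (by positivity)
  nlinarith [sq_nonneg (∑ i : Fin (2*n), x (Fin.castSucc i) ^ 2)]

lemma knorm_eq_zero (n : ℕ) (x : HX n) (h : knorm n x = 0) : x = 0 := by
  funext i
  refine Fin.lastCases ?_ (fun j => ?_) i
  · have := abs_last_le_knorm n x
    rw [h] at this; simpa using this
  · have := abs_le_knorm n x j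
    rw [h] at this; simpa using this

lemma knorm_pos (n : ℕ) (x : HX n) (h : x ≠ 0) : 0 < knorm n x :=
  lt_of_le_of_ne (knorm_nonneg n x) (fun h' => h (knorm_eq_zero n x h'.symm))

lemma ae_knorm_pos (n : ℕ) : ∀ᵐ x : HX n, 0 < knorm n x := by
  have : ∀ᵐ x : HX n, x ≠ 0 := by
    rw [ae_iff]; simp
  filter_upwards [this] with x hx using knorm_pos n x hx

lemma Qr_pos (n : ℕ) : 0 < Qr n := by unfold Qr; positivity

lemma knorm_hdil (n : ℕ) (r : ℝ) (hr : 0 ≤ r) (x : HX n) :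
    knorm n (hdil n r x) = r * knorm n x := by
  refine (pow_left_inj₀ (knorm_nonneg _ _) (mul_nonneg hr (knorm_nonneg _ _))
    (n := 4) (by norm_num)).1 ?_
  rw [mul_pow, knorm_pow4, knorm_pow4]
  simp only [hdil, Fin.val_castSucc, Fin.is_lt, if_true, Fin.val_last, lt_irrefl, if_false, mul_pow,
    ← Finset.mul_sum]
  ring

/-- the dilation as a linear map -/
def hdilL (n : ℕ) (r : ℝ) : HX n →ₗ[ℝ] HX n :=
  Matrix.toLin' (Matrix.diagonal fun i : Fin (2*n+1) => if (i : ℕ) < 2*n then r else r^2)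

lemma hdilL_apply (n : ℕ) (r : ℝ) (x : HX n) : hdilL n r x = hdil n r x := by
  funext i
  simp only [hdilL, Matrix.toLin'_apply, Matrix.mulVec_diagonal, hdil]
  split_ifs <;> rfl

lemma det_hdilL (n : ℕ) (r : ℝ) : LinearMap.det (hdilL n r) = r ^ (2*n+2) := by
  rw [hdilL, LinearMap.det_toLin', Matrix.det_diagonal, Fin.prod_univ_castSucc]
  simp [pow_add]

lemma continuous_hdil2 (n : ℕ) : Continuous (fun p : ℝ × HX n => hdil n p.1 p.2) := by
  refine continuous_pi fun i => ?_
  unfold hdil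
  split_ifs <;> fun_prop

lemma hdil_hdil (n : ℕ) (r s : ℝ) (x : HX n) : hdil n r (hdil n s x) = hdil n (r*s) x := by
  funext i
  unfold hdil
  split_ifs <;> ring

lemma hdil_one (n : ℕ) (x : HX n) : hdil n 1 x = x := by
  funext i
  unfold hdil
  split_ifs <;> ring

lemma measurable_hdil (n : ℕ) (r : ℝ) : Measurable (hdil n r) :=
  ((continuous_hdil2 n).comp (by fun_prop : Continuous fun x : HX n => (r, x))).measurable

/-- dilation as a measurable equivalence -/
def hdilE (n : ℕ) (r : ℝ) (hr : 0 < r) : HX n ≃ᵐ HX n where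
  toFun := hdil n r
  invFun := hdil n r⁻¹
  left_inv x := by rw [hdil_hdil, inv_mul_cancel₀ hr.ne', hdil_one]
  right_inv x := by rw [hdil_hdil, mul_inv_cancel₀ hr.ne', hdil_one]
  measurable_toFun := measurable_hdil n r
  measurable_invFun := measurable_hdil n r⁻¹

lemma Qr_rpow (n : ℕ) (r : ℝ) : r ^ Qr n = r ^ (2*n+2) := by
  rw [← Real.rpow_natCast]; unfold Qr; push_cast; rfl

lemma map_hdil (n : ℕ) (r : ℝ) (hr : 0 < r) :
    Measure.map (hdil n r) (volume : Measure (HX n)) = ENNReal.ofReal (r ^ Qr n)⁻¹ • volume := by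
  have h := Measure.map_linearMap_addHaar_eq_smul_addHaar (volume : Measure (HX n))
    (f := hdilL n r) (by rw [det_hdilL]; positivity)
  rw [det_hdilL] at h
  have h2 : (⇑(hdilL n r)) = hdil n r := funext (hdilL_apply n r)
  rw [h2] at h
  rw [h, Qr_rpow, abs_of_pos (by positivity)]

lemma lintegral_hdil (n : ℕ) (r : ℝ) (hr : 0 < r) (f : HX n → ℝ≥0∞) :
    ∫⁻ x, f (hdil n r x) = ENNReal.ofReal (r ^ Qr n)⁻¹ * ∫⁻ x, f x := by
  have h := lintegral_map_equiv (μ := (volume : Measure (HX n))) f (hdilE n r hr)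
  change ∫⁻ a, f a ∂(Measure.map (hdil n r) volume) = ∫⁻ x, f (hdil n r x) at h
  rw [← h, map_hdil n r hr, lintegral_smul_measure, smul_eq_mul]

lemma lintegral_hdil_pi (n m : ℕ) (r : ℝ) (hr : 0 < r) (f : (Fin m → HX n) → ℝ≥0∞) :
    ∫⁻ z : Fin m → HX n, f (fun j => hdil n r (z j)) = ENNReal.ofReal ((r ^ Qr n) ^ m)⁻¹ * ∫⁻ x, f x := by
  let T : (Fin m → HX n) →ₗ[ℝ] (Fin m → HX n) := LinearMap.pi fun i => hdilL n r ∘ₗ LinearMap.proj i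
  have hdet : LinearMap.det T = (r ^ (2*n+2)) ^ m := by
    have := LinearMap.det_pi (R := ℝ) (M := HX n) (ι := Fin m) (fun _ => hdilL n r)
    simp only [det_hdilL, Finset.prod_const, Finset.card_univ, Fintype.card_fin] at this
    exact this
  have h := Measure.map_linearMap_addHaar_eq_smul_addHaar (volume : Measure (Fin m → HX n))
    (f := T) (by rw [hdet]; positivity)
  have hT : (⇑T) = fun (z : Fin m → HX n) j => hdil n r (z j) := by
    funext z j
    simp [T, hdilL_apply]
  let E : (Fin m → HX n) ≃ᵐ (Fin m → HX n) := MeasurableEquiv.piCongrRight (fun _ => hdilE n r hr)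
  have h3 := lintegral_map_equiv (μ := (volume : Measure (Fin m → HX n))) f E
  change ∫⁻ a, f a ∂(Measure.map (fun (z : Fin m → HX n) j => hdil n r (z j)) volume)
    = ∫⁻ x : Fin m → HX n, f (fun j => hdil n r (x j)) at h3
  rw [← h3, ← hT, h, lintegral_smul_measure, smul_eq_mul, hdet, Qr_rpow, abs_of_pos (by positivity)]

lemma hmul_hdil (n : ℕ) (t : ℝ) (x y : HX n) :
    hmul n (hdil n t x) (hdil n t y) = hdil n t (hmul n x y) := by
  funext i
  have h1 : ∀ j : Fin n, (j : ℕ) < 2 * n := fun j => by omega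
  have h2 : ∀ j : Fin n, n + (j : ℕ) < 2 * n := fun j => by omega
  simp only [hmul, hdil, h1, h2, if_true]
  split_ifs with h
  · ring
  · rw [mul_add (t^2), mul_add (t^2), Finset.mul_sum, Finset.mul_sum, Finset.mul_sum]
    congr 1
    refine Finset.sum_congr rfl fun j _ => ?_
    ring

lemma hdist_hdil (n : ℕ) (t : ℝ) (ht : 0 ≤ t) (x y : HX n) :
    hdist n (hdil n t x) (hdil n t y) = t * hdist n x y := by
  unfold hdist
  have : (fun i => - hdil n t y i) = hdil n t (fun i => - y i) := by
    funext i; unfold hdil; split_ifs <;> ring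
  rw [this, hmul_hdil, knorm_hdil n t ht]

lemma mem_hball_hdil (n : ℕ) (t : ℝ) (ht : 0 < t) (a y : HX n) (R : ℝ) :
    hdil n t y ∈ hball n (hdil n t a) (t * R) ↔ y ∈ hball n a R := by
  unfold hball
  simp only [Set.mem_ofPred_eq, hdist_hdil n t ht.le]
  exact mul_lt_mul_iff_right₀ ht

lemma continuous_hdist (n : ℕ) (a : HX n) : Continuous (hdist n a) := by
  unfold hdist
  refine (continuous_knorm n).comp (continuous_pi fun i => ?_)
  unfold hmul
  split_ifs <;> fun_prop

lemma isOpen_hball (n : ℕ) (a : HX n) (R : ℝ) : IsOpen (hball n a R) :=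
  isOpen_lt (continuous_hdist n a) continuous_const

lemma measurableSet_hball (n : ℕ) (a : HX n) (R : ℝ) : MeasurableSet (hball n a R) :=
  (isOpen_hball n a R).measurableSet

/-- scaling for set integrals over balls -/
lemma setLIntegral_hdil (n : ℕ) (t : ℝ) (ht : 0 < t) (a : HX n) (R : ℝ) (f : HX n → ℝ≥0∞) :
    ∫⁻ x in hball n a R, f (hdil n t x) =
      ENNReal.ofReal (t ^ Qr n)⁻¹ * ∫⁻ x in hball n (hdil n t a) (t * R), f x := by
  rw [← lintegral_indicator (measurableSet_hball _ _ _),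
    ← lintegral_indicator (measurableSet_hball _ _ _), ← lintegral_hdil n t ht]
  congr 1
  funext x
  by_cases h : x ∈ hball n a R
  · rw [Set.indicator_of_mem h, Set.indicator_of_mem ((mem_hball_hdil n t ht a x R).2 h)]
  · rw [Set.indicator_of_notMem h,
      Set.indicator_of_notMem (fun h' => h ((mem_hball_hdil n t ht a x R).1 h'))]

lemma ae_pi_pos (n m : ℕ) : ∀ᵐ z : Fin m → HX n, ∀ j, 0 < knorm n (z j) := by
  rw [ae_all_iff]
  intro j
  exact (Measure.quasiMeasurePreserving_eval (μ := fun _ : Fin m => (volume : Measure (HX n))) j).ae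
    (ae_knorm_pos n)

/-- change of variables in the operator -/
lemma cov (n m : ℕ) (r : ℝ) (hr : 0 < r) (f : Fin m → HX n → ℝ) :
    ∫⁻ y : Fin m → HX n, ENNReal.ofReal ((∏ j, f j (y j)) /
        (r ^ Qr n + ∑ j, knorm n (y j) ^ Qr n) ^ m) =
    ∫⁻ z : Fin m → HX n, ENNReal.ofReal ((∏ j, f j (hdil n r (z j))) /
        (1 + ∑ j, knorm n (z j) ^ Qr n) ^ m) := by
  have h := lintegral_hdil_pi n m r hr (fun y => ENNReal.ofReal ((∏ j, f j (y j)) /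
        (r ^ Qr n + ∑ j, knorm n (y j) ^ Qr n) ^ m))
  have hc : 0 < (r ^ Qr n) ^ m := by positivity
  have h2 : ∫⁻ y : Fin m → HX n, ENNReal.ofReal ((∏ j, f j (y j)) /
        (r ^ Qr n + ∑ j, knorm n (y j) ^ Qr n) ^ m) =
      ENNReal.ofReal ((r ^ Qr n) ^ m) * ∫⁻ z : Fin m → HX n,
        ENNReal.ofReal ((∏ j, f j (hdil n r (z j))) /
        (r ^ Qr n + ∑ j, knorm n (hdil n r (z j)) ^ Qr n) ^ m) := by
    rw [h, ← mul_assoc, ← ENNReal.ofReal_mul hc.le, mul_inv_cancel₀ hc.ne', ENNReal.ofReal_one,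
      one_mul]
  rw [h2, ← lintegral_const_mul' _ _ ENNReal.ofReal_ne_top]
  congr 1
  funext z
  rw [← ENNReal.ofReal_mul hc.le]
  congr 1
  have : r ^ Qr n + ∑ j, knorm n (hdil n r (z j)) ^ Qr n =
      r ^ Qr n * (1 + ∑ j, knorm n (z j) ^ Qr n) := by
    rw [mul_add, mul_one, Finset.mul_sum]
    congr 1
    refine Finset.sum_congr rfl fun j _ => ?_
    rw [knorm_hdil n r hr.le, Real.mul_rpow hr.le (knorm_nonneg _ _)]
  rw [this, mul_pow]
  have : 0 < (1 + ∑ j, knorm n (z j) ^ Qr n) ^ m := by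
    have : 0 ≤ ∑ j, knorm n (z j) ^ Qr n :=
      Finset.sum_nonneg fun j _ => Real.rpow_nonneg (knorm_nonneg _ _) _
    positivity
  field_simp

lemma ofReal_hilbOp_le (n m : ℕ) (f : Fin m → HX n → ℝ) (hf : ∀ j x, 0 ≤ f j x) (x : HX n) :
    ENNReal.ofReal (hilbOp n m f x) ≤ ∫⁻ y : Fin m → HX n, ENNReal.ofReal ((∏ j, f j (y j)) /
        (knorm n x ^ Qr n + ∑ j, knorm n (y j) ^ Qr n) ^ m) := by
  unfold hilbOp
  by_cases hI : Integrable (fun y : Fin m → HX n => (∏ j, f j (y j)) /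
        (knorm n x ^ Qr n + ∑ j, knorm n (y j) ^ Qr n) ^ m)
  · rw [ofReal_integral_eq_lintegral_ofReal hI]
    refine Filter.Eventually.of_forall fun y => ?_
    have h1 : 0 ≤ ∑ j, knorm n (y j) ^ Qr n :=
      Finset.sum_nonneg fun j _ => Real.rpow_nonneg (knorm_nonneg _ _) _
    have h2 : 0 ≤ knorm n x ^ Qr n := Real.rpow_nonneg (knorm_nonneg _ _) _
    have h3 : 0 ≤ ∏ j, f j (y j) := Finset.prod_nonneg fun j _ => hf j _
    exact div_nonneg h3 (pow_nonneg (add_nonneg h2 h1) m)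
  · rw [integral_undef hI]; simp

lemma hilbOp_nonneg (n m : ℕ) (f : Fin m → HX n → ℝ) (hf : ∀ j x, 0 ≤ f j x) (x : HX n) :
    0 ≤ hilbOp n m f x := by
  unfold hilbOp
  refine integral_nonneg fun y => ?_
  have h1 : 0 ≤ ∑ j, knorm n (y j) ^ Qr n :=
    Finset.sum_nonneg fun j _ => Real.rpow_nonneg (knorm_nonneg _ _) _
  have h2 : 0 ≤ knorm n x ^ Qr n := Real.rpow_nonneg (knorm_nonneg _ _) _
  have h3 : 0 ≤ ∏ j, f j (y j) := Finset.prod_nonneg fun j _ => hf j _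
  exact div_nonneg h3 (pow_nonneg (add_nonneg h2 h1) m)

lemma measurable_den (n m : ℕ) (c : ℝ) :
    Measurable (fun y : Fin m → HX n => (c + ∑ j, knorm n (y j) ^ Qr n) ^ m) := by
  refine Measurable.pow_const (measurable_const.add (Finset.measurable_sum _ fun j _ => ?_)) _
  exact ((measurable_knorm n).comp (measurable_pi_apply j)).pow_const _

lemma aem_of_hilb (n m : ℕ) (f : Fin m → HX n → ℝ) (x : HX n)
    (hx : hilbOp n m f x ≠ 0) (i : Fin m) : AEMeasurable (f i) := by
  have hI : Integrable (fun y : Fin m → HX n => (∏ j, f j (y j)) /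
        (knorm n x ^ Qr n + ∑ j, knorm n (y j) ^ Qr n) ^ m) := by
    by_contra h
    exact hx (integral_undef h)
  have hne : ¬ (∀ᵐ y : Fin m → HX n, ∏ j, f j (y j) = 0) := by
    intro h
    apply hx
    unfold hilbOp
    rw [integral_eq_zero_of_ae]
    filter_upwards [h] with y hy
    simp [hy]
  have hH : AEMeasurable (fun y : Fin m → HX n => ∏ j, f j (y j)) := by
    refine (hI.aestronglyMeasurable.aemeasurable.mul
      (measurable_den n m (knorm n x ^ Qr n)).aemeasurable).congr ?_
    filter_upwards [ae_pi_pos n m] with y hy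
    have h1 : 0 < ∑ j, knorm n (y j) ^ Qr n :=
      Finset.sum_pos (fun j _ => Real.rpow_pos_of_pos (hy j) _) ⟨i, Finset.mem_univ _⟩
    have h2 : 0 ≤ knorm n x ^ Qr n := Real.rpow_nonneg (knorm_nonneg _ _) _
    simp only [Pi.mul_apply]
    have : (knorm n x ^ Qr n + ∑ j, knorm n (y j) ^ Qr n) ^ m ≠ 0 :=
      (pow_pos (add_pos_of_nonneg_of_pos h2 h1) m).ne'
    exact div_mul_cancel₀ _ this
  obtain _ | m := m
  · exact i.elim0
  have hvp := volume_preserving_piFinSuccAbove (fun _ : Fin (m+1) => HX n) i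
  set e := MeasurableEquiv.piFinSuccAbove (fun _ : Fin (m+1) => HX n) i with he
  have h1 := hH.comp_quasiMeasurePreserving (hvp.symm e).quasiMeasurePreserving
  have h2 : ∀ p : HX n × (Fin m → HX n), ∏ j, f j (e.symm p j) =
      f i p.1 * ∏ k, f (i.succAbove k) (p.2 k) := by
    intro p
    rw [Fin.prod_univ_succAbove _ i]
    have hp : e.symm p = i.insertNth p.1 p.2 := rfl
    rw [hp]
    simp
  have h3 : AEMeasurable (fun p : HX n × (Fin m → HX n) =>
      f i p.1 * ∏ k, f (i.succAbove k) (p.2 k)) (volume.prod volume) := by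
    refine h1.congr (Filter.Eventually.of_forall fun p => ?_)
    exact h2 p
  have h4 := (h3.prod_swap).aestronglyMeasurable.prodMk_left
  have h5 : ∃ᵐ y' : Fin m → HX n, ∏ k, f (i.succAbove k) (y' k) ≠ 0 := by
    intro hcon
    apply hne
    have h6 : ∀ᵐ p : HX n × (Fin m → HX n), ∏ k, f (i.succAbove k) (p.2 k) = 0 := by
      have := (Measure.quasiMeasurePreserving_snd (μ := (volume : Measure (HX n)))
        (ν := (volume : Measure (Fin m → HX n)))).ae hcon
      filter_upwards [this] with p hp
      simpa using hp
    have h7 := hvp.quasiMeasurePreserving.ae h6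
    filter_upwards [h7] with y hy
    have := h2 (e y)
    rw [hy, mul_zero] at this
    simpa using this
  obtain ⟨y', hy1, hy2⟩ := (h5.and_eventually h4).exists
  have h8 := (hy2.aemeasurable).mul_const (∏ k, f (i.succAbove k) (y' k))⁻¹
  refine h8.congr (Filter.Eventually.of_forall fun t => ?_)
  simp only [Prod.swap]
  field_simp

lemma qmp_hdil_pi (n m : ℕ) (j : Fin m) : Measure.QuasiMeasurePreserving
    (fun p : HX n × (Fin m → HX n) => hdil n (knorm n p.1) (p.2 j)) (volume.prod volume) volume := by
  have hm : Measurable (fun p : HX n × (Fin m → HX n) => hdil n (knorm n p.1) (p.2 j)) := by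
    refine ((continuous_hdil2 n).comp (((continuous_knorm n).comp continuous_fst).prodMk
      ((continuous_apply j).comp continuous_snd))).measurable
  refine ⟨hm, Measure.AbsolutelyContinuous.mk fun s hs h0 => ?_⟩
  rw [Measure.map_apply hm hs, Measure.measure_prod_null (hm hs)]
  filter_upwards [ae_knorm_pos n] with x hx
  have h1 : volume (hdil n (knorm n x) ⁻¹' s) = 0 := by
    rw [← Measure.map_apply (measurable_hdil n _) hs, map_hdil n _ hx]
    simp [h0]
  exact (Measure.quasiMeasurePreserving_eval
    (μ := fun _ : Fin m => (volume : Measure (HX n))) j).preimage_null h1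

lemma qmp_hdil1 (n : ℕ) (t : ℝ) (ht : 0 < t) : Measure.QuasiMeasurePreserving
    (hdil n t) (volume : Measure (HX n)) volume := by
  refine ⟨measurable_hdil n t, ?_⟩
  rw [map_hdil n t ht]
  exact Measure.smul_absolutelyContinuous

/-- the weight integral over a ball -/
def wB (n : ℕ) (al : ℝ) (a : HX n) (R : ℝ) : ℝ≥0∞ :=
  ∫⁻ x in hball n a R, ENNReal.ofReal (knorm n x ^ al)

lemma wB_hdil (n : ℕ) (al : ℝ) (a : HX n) (R t : ℝ) (ht : 0 < t) :
    wB n al (hdil n t a) (t * R) = ENNReal.ofReal (t ^ (Qr n + al)) * wB n al a R := by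
  unfold wB
  have h := setLIntegral_hdil n t ht a R (fun x => ENNReal.ofReal (knorm n x ^ al))
  have h1 : ∀ x : HX n, ENNReal.ofReal (knorm n (hdil n t x) ^ al) =
      ENNReal.ofReal (t ^ al) * ENNReal.ofReal (knorm n x ^ al) := by
    intro x
    rw [knorm_hdil n t ht.le, Real.mul_rpow ht.le (knorm_nonneg _ _),
      ENNReal.ofReal_mul (by positivity)]
  simp only [h1] at h
  rw [lintegral_const_mul' _ _ ENNReal.ofReal_ne_top] at h
  rw [Real.rpow_add ht, ENNReal.ofReal_mul (by positivity), mul_assoc, h, ← mul_assoc,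
    ← ENNReal.ofReal_mul (by positivity), mul_inv_cancel₀ (by positivity), ENNReal.ofReal_one,
    one_mul]

lemma le_morreyNorm (n : ℕ) (q lam al ga : ℝ) (f : HX n → ℝ) (a : HX n) (R : ℝ) (hR : 0 < R) :
    wB n al a R ^ (-(lam + 1/q)) *
    (∫⁻ x in hball n a R, ENNReal.ofReal (|f x| ^ q * knorm n x ^ ga)) ^ (1/q) ≤
      morreyNorm n q lam al ga f := by
  unfold morreyNorm wB
  exact le_iSup_of_le a (le_iSup_of_le R (le_iSup_of_le hR le_rfl))

lemma dil_bound (n : ℕ) (p lam al g : ℝ) (hp : 0 < p) (f : HX n → ℝ) (a : HX n) (R t : ℝ)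
    (hR : 0 < R) (ht : 0 < t) (h0 : wB n al a R ≠ 0) (hT : wB n al a R ≠ ⊤) :
    ∫⁻ x in hball n a R, ENNReal.ofReal (|f (hdil n t x)| ^ p * knorm n x ^ g) ≤
      ENNReal.ofReal (t ^ (Qr n * lam - g/p + al * (lam + 1/p))) ^ p *
       morreyNorm n p lam al g f ^ p * wB n al a R ^ (p * (lam + 1/p)) := by
  have hW := wB_hdil n al a R t ht
  have hN := le_morreyNorm n p lam al g f (hdil n t a) (t * R) (by positivity)
  set N := morreyNorm n p lam al g f
  set W := wB n al a R
  set W' := wB n al (hdil n t a) (t * R)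
  have hc0 : ENNReal.ofReal (t ^ (Qr n + al)) ≠ 0 := by
    rw [Ne, ENNReal.ofReal_eq_zero, not_le]; positivity
  have hW0 : W' ≠ 0 := by rw [hW]; exact mul_ne_zero hc0 h0
  have hWT : W' ≠ ⊤ := by rw [hW]; exact ENNReal.mul_ne_top ENNReal.ofReal_ne_top hT
  have hs := setLIntegral_hdil n t ht a R (fun x => ENNReal.ofReal (|f x| ^ p * knorm n x ^ g))
  set I' := ∫⁻ x in hball n (hdil n t a) (t * R), ENNReal.ofReal (|f x| ^ p * knorm n x ^ g)
  have hI' : I' ≤ N ^ p * W' ^ (p * (lam + 1/p)) := by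
    have h1 : I' ^ (1/p) ≤ N * W' ^ (lam + 1/p) := by
      calc I' ^ (1/p) = (W' ^ (-(lam + 1/p)) * I' ^ (1/p)) * W' ^ (lam + 1/p) := by
            rw [mul_right_comm, ← ENNReal.rpow_add _ _ hW0 hWT]; simp
        _ ≤ _ := by gcongr
    have h2 := ENNReal.rpow_le_rpow h1 hp.le
    rw [← ENNReal.rpow_mul, one_div, inv_mul_cancel₀ hp.ne', ENNReal.rpow_one,
      ENNReal.mul_rpow_of_nonneg _ _ hp.le, ← ENNReal.rpow_mul, ← one_div, mul_comm _ p] at h2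
    exact h2
  have h3 : ∀ x : HX n, ENNReal.ofReal (|f (hdil n t x)| ^ p * knorm n x ^ g) =
      ENNReal.ofReal (t ^ (-g)) *
        ENNReal.ofReal (|f (hdil n t x)| ^ p * knorm n (hdil n t x) ^ g) := by
    intro x
    rw [← ENNReal.ofReal_mul (by positivity), knorm_hdil n t ht.le,
      Real.mul_rpow ht.le (knorm_nonneg _ _), Real.rpow_neg ht.le]
    congr 1
    have : t ^ g ≠ 0 := by positivity
    field_simp
  simp only [h3]
  rw [lintegral_const_mul' _ _ ENNReal.ofReal_ne_top, hs]
  calc _ ≤ ENNReal.ofReal (t ^ (-g)) * (ENNReal.ofReal (t ^ Qr n)⁻¹ *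
        (N ^ p * W' ^ (p * (lam + 1/p)))) := by gcongr
    _ = _ := by
      rw [hW, ENNReal.mul_rpow_of_ne_zero hc0 h0, ENNReal.ofReal_rpow_of_pos (by positivity),
        ENNReal.ofReal_rpow_of_pos (by positivity)]
      have : t ^ (-g) * ((t ^ Qr n)⁻¹ * (t ^ (Qr n + al)) ^ (p * (lam + 1/p))) =
          (t ^ (Qr n * lam - g / p + al * (lam + 1 / p))) ^ p := by
        rw [← Real.rpow_neg ht.le, ← Real.rpow_mul ht.le, ← Real.rpow_mul ht.le,
          ← Real.rpow_add ht, ← Real.rpow_add ht]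
        congr 1
        field_simp
        ring
      rw [← this, ENNReal.ofReal_mul (by positivity), ENNReal.ofReal_mul (by positivity)]
      ring

lemma prod_bound (n m : ℕ) (q lam al ga : ℝ) (qj lamj gaj : Fin m → ℝ)
    (hq : 1 ≤ q) (hqj : ∀ j, 1 < qj j)
    (hsum : 1/q = ∑ j, 1/(qj j)) (hga : ga = ∑ j, gaj j)
    (hql : ∀ j, q * lam = qj j * lamj j)
    (f : Fin m → HX n → ℝ) (hf : ∀ j x, 0 ≤ f j x)
    (hr : ∀ j x y, knorm n x = knorm n y → f j x = f j y)
    (hm : ∀ j, AEMeasurable (f j))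
    (a : HX n) (R : ℝ) (hR : 0 < R) (h0 : wB n al a R ≠ 0) (hT : wB n al a R ≠ ⊤)
    (z : Fin m → HX n) (hz : ∀ j, 0 < knorm n (z j)) :
    ∫⁻ x in hball n a R, (∏ j, ENNReal.ofReal (f j (hdil n (knorm n x) (z j)))) ^ q *
        ENNReal.ofReal (knorm n x ^ ga) ≤
      (∏ j, ENNReal.ofReal (knorm n (z j) ^
        (Qr n * lamj j - gaj j / q + al * (lamj j + 1/(qj j))))) ^ q *
      (∏ j, morreyNorm n (qj j) (lamj j) al (qj j * gaj j / q) (f j)) ^ q *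
      wB n al a R ^ (q * (lam + 1/q)) := by
  have hq0 : 0 < q := by linarith
  have hqj0 : ∀ j, 0 < qj j := fun j => by linarith [hqj j]
  set G : Fin m → HX n → ℝ≥0∞ := fun j x =>
    ENNReal.ofReal (|f j (hdil n (knorm n (z j)) x)| ^ (qj j) * knorm n x ^ (qj j * gaj j / q)) with hG
  have hpt : ∀ᵐ x ∂(volume.restrict (hball n a R)),
      (∏ j, ENNReal.ofReal (f j (hdil n (knorm n x) (z j)))) ^ q *
        ENNReal.ofReal (knorm n x ^ ga) = ∏ j, (G j x) ^ (q / qj j) := by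
    filter_upwards [ae_restrict_of_ae (ae_knorm_pos n)] with x hx
    rw [hga, Real.rpow_sum_of_pos hx, ENNReal.ofReal_prod_of_nonneg (fun j _ => by positivity),
      ← ENNReal.prod_rpow_of_nonneg hq0.le, ← Finset.prod_mul_distrib]
    refine Finset.prod_congr rfl fun j _ => ?_
    have h1 : f j (hdil n (knorm n x) (z j)) = f j (hdil n (knorm n (z j)) x) := by
      apply hr
      rw [knorm_hdil _ _ (knorm_nonneg _ _), knorm_hdil _ _ (knorm_nonneg _ _), mul_comm]
    have h2 := hf j (hdil n (knorm n (z j)) x)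
    have h3 := hqj0 j
    simp only [hG]
    rw [h1, abs_of_nonneg h2, ENNReal.ofReal_rpow_of_nonneg h2 hq0.le,
      ENNReal.ofReal_rpow_of_nonneg (by positivity) (by positivity), ← ENNReal.ofReal_mul (by positivity),
      Real.mul_rpow (by positivity) (by positivity), ← Real.rpow_mul h2, ← Real.rpow_mul hx.le]
    congr 3
    · field_simp
    · field_simp
  rw [lintegral_congr_ae hpt]
  have hGm : ∀ j ∈ (Finset.univ : Finset (Fin m)),
      AEMeasurable (G j) (volume.restrict (hball n a R)) := by
    intro j _
    have h1 : AEMeasurable (fun x => f j (hdil n (knorm n (z j)) x)) :=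
      (hm j).comp_quasiMeasurePreserving (qmp_hdil1 n _ (hz j))
    have h2 : AEMeasurable (fun x : HX n => |f j (hdil n (knorm n (z j)) x)|) :=
      measurable_norm.comp_aemeasurable h1
    exact (((h2.pow_const (qj j)).mul
      ((measurable_knorm n).pow_const _).aemeasurable).ennreal_ofReal).restrict
  have hp : ∑ j, q / qj j = 1 := by
    have : ∀ j, q / qj j = q * (1 / qj j) := fun j => by ring
    simp only [this]
    rw [← Finset.mul_sum, ← hsum]
    field_simp
  refine (ENNReal.lintegral_prod_norm_pow_le Finset.univ hGm hp
    (fun j _ => by have := hqj0 j; positivity)).trans ?_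
  have hstep : ∀ j, (∫⁻ x in hball n a R, G j x) ^ (q / qj j) ≤
      ENNReal.ofReal (knorm n (z j) ^
        (Qr n * lamj j - gaj j / q + al * (lamj j + 1/(qj j)))) ^ q *
      morreyNorm n (qj j) (lamj j) al (qj j * gaj j / q) (f j) ^ q *
      wB n al a R ^ (q * (lamj j + 1/ qj j)) := by
    intro j
    have hj := hqj0 j
    have h1 := dil_bound n (qj j) (lamj j) al (qj j * gaj j / q) hj (f j) a R _ hR (hz j) h0 hT
    have h2 : 0 ≤ q / qj j := by positivity
    refine (ENNReal.rpow_le_rpow h1 h2).trans (le_of_eq ?_)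
    rw [ENNReal.mul_rpow_of_nonneg _ _ h2, ENNReal.mul_rpow_of_nonneg _ _ h2,
      ← ENNReal.rpow_mul, ← ENNReal.rpow_mul, ← ENNReal.rpow_mul]
    have e1 : qj j * (q / qj j) = q := by field_simp
    have e2 : qj j * (lamj j + 1 / qj j) * (q / qj j) = q * (lamj j + 1 / qj j) := by field_simp
    have e3 : qj j * gaj j / q / qj j = gaj j / q := by field_simp
    rw [e1, e2, e3]
  refine (Finset.prod_le_prod' fun j _ => hstep j).trans (le_of_eq ?_)
  rw [Finset.prod_mul_distrib, Finset.prod_mul_distrib, ENNReal.prod_rpow_of_nonneg hq0.le,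
    ENNReal.prod_rpow_of_nonneg hq0.le]
  congr 1
  have hl : ∑ j, q * (lamj j + 1 / qj j) = q * (lam + 1/q) := by
    have : ∀ j, q * (lamj j + 1 / qj j) = q * (q * lam + 1) * (1 / qj j) := by
      intro j
      have hj := hqj0 j
      rw [hql j]
      field_simp
    simp only [this]
    rw [← Finset.mul_sum, ← hsum]
    field_simp
  rw [← hl]
  have key : ∀ s : Finset (Fin m), ∏ j ∈ s, wB n al a R ^ (q * (lamj j + 1/ qj j)) =
      wB n al a R ^ (∑ j ∈ s, q * (lamj j + 1/ qj j)) := by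
    intro s
    induction s using Finset.induction_on with
    | empty => simp
    | insert i s hi ih => rw [Finset.prod_insert hi, Finset.sum_insert hi, ih,
        ENNReal.rpow_add _ _ h0 hT]
  exact key _

lemma den_pos (n m : ℕ) (z : Fin m → HX n) : 0 < (1 + ∑ j, knorm n (z j) ^ Qr n) ^ m := by
  have : 0 ≤ ∑ j, knorm n (z j) ^ Qr n :=
    Finset.sum_nonneg fun j _ => Real.rpow_nonneg (knorm_nonneg _ _) _
  positivity

lemma upper (n m : ℕ) (q lam al ga : ℝ) (qj lamj gaj : Fin m → ℝ)
    (hq : 1 ≤ q) (hqj : ∀ j, 1 < qj j) (hlam : 0 < lam + 1/q)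
    (hsum : 1/q = ∑ j, 1/(qj j)) (hga : ga = ∑ j, gaj j)
    (hql : ∀ j, q * lam = qj j * lamj j)
    (f : Fin m → HX n → ℝ) (hf : ∀ j x, 0 ≤ f j x)
    (hr : ∀ j x y, knorm n x = knorm n y → f j x = f j y)
    (hB : Bconst n m (fun j => Qr n * lamj j - gaj j / q + al * (lamj j + 1/(qj j))) < ⊤) :
    morreyNorm n q lam al ga (hilbOp n m f) ≤
      Bconst n m (fun j => Qr n * lamj j - gaj j / q + al * (lamj j + 1/(qj j))) *
       ∏ j, morreyNorm n (qj j) (lamj j) al (qj j * gaj j / q) (f j) := by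
  have hq0 : 0 < q := by linarith
  by_cases hz : ∀ x, hilbOp n m f x = 0
  · have : morreyNorm n q lam al ga (hilbOp n m f) = 0 := by
      unfold morreyNorm
      simp [hz, Real.zero_rpow hq0.ne', hq0]
    rw [this]; exact zero_le
  push Not at hz
  obtain ⟨x0, hx0⟩ := hz
  have hm := aem_of_hilb n m f x0 hx0
  set e : Fin m → ℝ := fun j => Qr n * lamj j - gaj j / q + al * (lamj j + 1/(qj j)) with he
  set N := ∏ j, morreyNorm n (qj j) (lamj j) al (qj j * gaj j / q) (f j) with hN
  set B := Bconst n m e with hBdef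
  unfold morreyNorm
  refine iSup_le fun a => iSup_le fun R => iSup_le fun hR => ?_
  change wB n al a R ^ (-(lam + 1/q)) * _ ≤ _
  by_cases h0 : wB n al a R = 0
  · have hvol : volume (hball n a R) = 0 := by
      unfold wB at h0
      rw [lintegral_eq_zero_iff ((measurable_knorm n).pow_const al).ennreal_ofReal] at h0
      by_contra hne
      have hfalse : ∀ᵐ x ∂(volume.restrict (hball n a R)), False := by
        filter_upwards [h0, ae_restrict_of_ae (ae_knorm_pos n)] with x hx1 hx2
        have : 0 < knorm n x ^ al := by positivity
        simp only [Pi.zero_apply, ENNReal.ofReal_eq_zero] at hx1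
        linarith
      rw [ae_iff] at hfalse
      simp at hfalse
      exact hne hfalse
    rw [Measure.restrict_eq_zero.2 hvol]
    simp [hq0]
  by_cases hT : wB n al a R = ⊤
  · rw [hT, ENNReal.top_rpow_of_neg (by linarith), zero_mul]; exact zero_le
  set W := wB n al a R with hW
  set μ := (volume : Measure (HX n)).restrict (hball n a R) with hμ
  -- basic functions
  set F : HX n → (Fin m → HX n) → ℝ≥0∞ := fun x z =>
    ∏ j, ENNReal.ofReal (f j (hdil n (knorm n x) (z j))) with hF
  set k : (Fin m → HX n) → ℝ≥0∞ := fun z =>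
    ENNReal.ofReal (((1 + ∑ j, knorm n (z j) ^ Qr n) ^ m)⁻¹) with hk
  set ψ : (Fin m → HX n) → ℝ≥0∞ := fun z => ∏ j, ENNReal.ofReal (knorm n (z j) ^ e j) with hψ
  have hkm : Measurable k := (measurable_den n m 1).inv.ennreal_ofReal
  have hψm : Measurable ψ := Finset.measurable_prod _ fun j _ =>
    (((measurable_knorm n).comp (measurable_pi_apply j)).pow_const _).ennreal_ofReal
  have hψ0 : ∀ z : Fin m → HX n, (∀ j, 0 < knorm n (z j)) → ψ z ≠ 0 := by
    intro z hz
    refine Finset.prod_ne_zero_iff.2 fun j _ => ?_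
    have := hz j
    rw [Ne, ENNReal.ofReal_eq_zero, not_le]; positivity
  have hψT : ∀ z : Fin m → HX n, ψ z ≠ ⊤ := fun z =>
    ENNReal.prod_ne_top fun j _ => ENNReal.ofReal_ne_top
  have hkT : ∀ z, k z ≠ ⊤ := fun z => ENNReal.ofReal_ne_top
  have hk0 : ∀ z, k z ≠ 0 := by
    intro z
    have := den_pos n m z
    simp only [hk]
    rw [Ne, ENNReal.ofReal_eq_zero, not_le]; positivity
  have hFm2 : AEMeasurable (Function.uncurry F) (μ.prod volume) := by
    have h1 : AEMeasurable (Function.uncurry F) ((volume : Measure (HX n)).prod volume) := by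
      refine Finset.aemeasurable_fun_prod _ fun j _ => ?_
      exact ((hm j).comp_quasiMeasurePreserving (qmp_hdil_pi n m j)).ennreal_ofReal
    exact h1.mono_ac (Measure.AbsolutelyContinuous.prod Measure.restrict_le_self.absolutelyContinuous
      Measure.AbsolutelyContinuous.rfl)
  have hBint : ∫⁻ z, ψ z * k z = B := by
    rw [hBdef]; unfold Bconst
    refine lintegral_congr fun z => ?_
    simp only [hψ, hk]
    rw [div_eq_mul_inv, ENNReal.ofReal_mul, ENNReal.ofReal_prod_of_nonneg]
    · intro j _; have := knorm_nonneg n (z j); positivity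
    · exact Finset.prod_nonneg fun j _ => by have := knorm_nonneg n (z j); positivity
  have hFx : ∀ x, 0 < knorm n x → AEMeasurable (F x) := by
    intro x hx
    refine Finset.aemeasurable_fun_prod _ fun j _ => ?_
    have h1 : AEMeasurable (fun w => f j (hdil n (knorm n x) w)) :=
      (hm j).comp_quasiMeasurePreserving (qmp_hdil1 n _ hx)
    exact (h1.comp_quasiMeasurePreserving (Measure.quasiMeasurePreserving_eval
      (μ := fun _ : Fin m => (volume : Measure (HX n))) j)).ennreal_ofReal
  -- Jensen
  have hJ : ∀ x, 0 < knorm n x → ENNReal.ofReal (|hilbOp n m f x| ^ q) ≤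
      (∫⁻ z, F x z ^ q * (ψ z ^ (1 - q) * k z)) * B ^ (q - 1) := by
    intro x hx
    have h1 := ofReal_hilbOp_le n m f hf x
    rw [cov n m _ hx f] at h1
    have h2 : ∫⁻ z : Fin m → HX n, ENNReal.ofReal ((∏ j, f j (hdil n (knorm n x) (z j))) /
        (1 + ∑ j, knorm n (z j) ^ Qr n) ^ m) =
        ∫⁻ z, (F x z ^ q * (ψ z ^ (1 - q) * k z)) ^ (1/q) * (ψ z * k z) ^ (1 - 1/q) := by
      refine lintegral_congr_ae ?_
      filter_upwards [ae_pi_pos n m] with z hz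
      have a1 : ENNReal.ofReal ((∏ j, f j (hdil n (knorm n x) (z j))) /
        (1 + ∑ j, knorm n (z j) ^ Qr n) ^ m) = F x z * k z := by
        simp only [hF, hk]
        rw [div_eq_mul_inv, ENNReal.ofReal_mul, ENNReal.ofReal_prod_of_nonneg]
        · intro j _; exact hf j _
        · exact Finset.prod_nonneg fun j _ => hf j _
      have hq1 : 0 ≤ 1 / q := by positivity
      have hq2 : 0 ≤ 1 - 1 / q := by
        rw [sub_nonneg, div_le_one hq0]; exact hq
      rw [a1, ENNReal.mul_rpow_of_nonneg _ _ hq1, ENNReal.mul_rpow_of_nonneg _ _ hq1,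
        ENNReal.mul_rpow_of_nonneg _ _ hq2, ← ENNReal.rpow_mul, ← ENNReal.rpow_mul,
        mul_one_div_cancel hq0.ne', ENNReal.rpow_one]
      have a2 : ψ z ^ ((1 - q) * (1/q)) * ψ z ^ (1 - 1/q) = 1 := by
        rw [← ENNReal.rpow_add _ _ (hψ0 z hz) (hψT z)]
        have : (1 - q) * (1/q) + (1 - 1/q) = 0 := by field_simp; ring
        rw [this, ENNReal.rpow_zero]
      have a3 : k z ^ (1/q) * k z ^ (1 - 1/q) = k z := by
        rw [← ENNReal.rpow_add _ _ (hk0 z) (hkT z)]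
        simp
      calc F x z * k z = F x z * ((ψ z ^ ((1 - q) * (1/q)) * ψ z ^ (1 - 1/q)) *
            (k z ^ (1/q) * k z ^ (1 - 1/q))) := by rw [a2, a3, one_mul]
        _ = _ := by ring
    rw [h2] at h1
    have hq1 : 0 ≤ 1 / q := by positivity
    have hq2 : 0 ≤ 1 - 1 / q := by
      rw [sub_nonneg, div_le_one hq0]; exact hq
    have h3 := ENNReal.lintegral_mul_norm_pow_le (μ := (volume : Measure (Fin m → HX n)))
      (f := fun z => F x z ^ q * (ψ z ^ (1 - q) * k z)) (g := fun z => ψ z * k z)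
      (((hFx x hx).pow_const q).mul ((hψm.pow_const _).mul hkm).aemeasurable)
      (hψm.mul hkm).aemeasurable hq1 hq2 (by ring)
    rw [hBint] at h3
    have h4 := ENNReal.rpow_le_rpow (h1.trans h3) hq0.le
    rw [ENNReal.ofReal_rpow_of_nonneg (hilbOp_nonneg n m f hf x) hq0.le,
      ENNReal.mul_rpow_of_nonneg _ _ hq0.le, ← ENNReal.rpow_mul, ← ENNReal.rpow_mul,
      one_div_mul_cancel hq0.ne', ENNReal.rpow_one] at h4
    rw [abs_of_nonneg (hilbOp_nonneg n m f hf x)]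
    have h5 : (1 - 1/q) * q = q - 1 := by field_simp
    rwa [h5] at h4
  have hfin : ∫⁻ x in hball n a R, ENNReal.ofReal (|hilbOp n m f x| ^ q * knorm n x ^ ga) ≤
      (B * N * W ^ (lam + 1/q)) ^ q := by
    have hwm : Measurable (fun x : HX n => ENNReal.ofReal (knorm n x ^ ga)) :=
      ((measurable_knorm n).pow_const _).ennreal_ofReal
    have hBT : B ^ (q - 1) ≠ ⊤ := ENNReal.rpow_ne_top_of_nonneg (by linarith) hB.ne
    have hmeasF : AEMeasurable (Function.uncurry fun x z =>
        F x z ^ q * ENNReal.ofReal (knorm n x ^ ga) * (ψ z ^ (1 - q) * k z)) (μ.prod volume) := by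
      refine ((hFm2.pow_const q).mul ?_).mul ?_
      · exact (hwm.comp measurable_fst).aemeasurable
      · exact (((hψm.pow_const (1-q)).mul hkm).comp measurable_snd).aemeasurable
    calc ∫⁻ x in hball n a R, ENNReal.ofReal (|hilbOp n m f x| ^ q * knorm n x ^ ga)
        ≤ ∫⁻ x, B ^ (q - 1) * (∫⁻ z,
          F x z ^ q * ENNReal.ofReal (knorm n x ^ ga) * (ψ z ^ (1 - q) * k z)) ∂μ := by
          refine lintegral_mono_ae ?_
          filter_upwards [ae_restrict_of_ae (ae_knorm_pos n)] with x hx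
          rw [ENNReal.ofReal_mul (by positivity)]
          have e1 : ∀ z, F x z ^ q * ENNReal.ofReal (knorm n x ^ ga) * (ψ z ^ (1 - q) * k z) =
            ENNReal.ofReal (knorm n x ^ ga) * (F x z ^ q * (ψ z ^ (1 - q) * k z)) :=
            fun z => by ring
          simp only [e1]
          rw [lintegral_const_mul' _ _ ENNReal.ofReal_ne_top]
          calc _ ≤ ((∫⁻ z, F x z ^ q * (ψ z ^ (1 - q) * k z)) * B ^ (q - 1)) *
                ENNReal.ofReal (knorm n x ^ ga) := by gcongr; exact hJ x hx
            _ = _ := by ring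
      _ = B ^ (q - 1) * ∫⁻ z, ∫⁻ x,
          F x z ^ q * ENNReal.ofReal (knorm n x ^ ga) * (ψ z ^ (1 - q) * k z) ∂μ := by
          rw [lintegral_const_mul' _ _ hBT, lintegral_lintegral_swap hmeasF]
      _ ≤ B ^ (q - 1) * ∫⁻ z, (N ^ q * W ^ (q * (lam + 1/q))) * (ψ z * k z) := by
          refine mul_le_mul' le_rfl ?_
          refine lintegral_mono_ae ?_
          filter_upwards [ae_pi_pos n m] with z hz
          have hc : ψ z ^ (1 - q) * k z ≠ ⊤ := by
            refine ENNReal.mul_ne_top ?_ (hkT z)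
            exact ENNReal.rpow_ne_top_of_ne_zero (hψ0 z hz) (hψT z)
          rw [lintegral_mul_const' _ _ hc]
          have hb := prod_bound n m q lam al ga qj lamj gaj hq hqj hsum hga hql f hf hr hm a R hR
            h0 hT z hz
          calc _ ≤ (ψ z ^ q * N ^ q * W ^ (q * (lam + 1/q))) * (ψ z ^ (1 - q) * k z) := by
                gcongr
            _ = (N ^ q * W ^ (q * (lam + 1/q))) * ((ψ z ^ q * ψ z ^ (1 - q)) * k z) := by ring
            _ = _ := by
              rw [← ENNReal.rpow_add _ _ (hψ0 z hz) (hψT z)]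
              simp
      _ = (B * N * W ^ (lam + 1/q)) ^ q := by
          rw [lintegral_const_mul _ (show Measurable (fun z => ψ z * k z) from hψm.mul hkm), hBint, ENNReal.mul_rpow_of_nonneg _ _ hq0.le,
            ENNReal.mul_rpow_of_nonneg _ _ hq0.le, ← ENNReal.rpow_mul, mul_comm (lam + 1/q) q]
          have : B ^ q = B ^ (q - 1) * B := by
            by_cases hB0 : B = 0
            · rw [hB0, ENNReal.zero_rpow_of_pos hq0, mul_zero]
            · conv_lhs => rw [show q = (q - 1) + 1 by ring, ENNReal.rpow_add _ _ hB0 hB.ne,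
                ENNReal.rpow_one]
          rw [this]; ring
  have h6 := ENNReal.rpow_le_rpow hfin (show 0 ≤ 1/q by positivity)
  rw [← ENNReal.rpow_mul, mul_one_div_cancel hq0.ne', ENNReal.rpow_one] at h6
  calc _ ≤ W ^ (-(lam + 1/q)) * (B * N * W ^ (lam + 1/q)) := by gcongr
    _ = B * N * (W ^ (-(lam + 1/q)) * W ^ (lam + 1/q)) := by ring
    _ = _ := by
      rw [← ENNReal.rpow_add _ _ h0 hT]
      simp

/-- annulus -/
def ann (n : ℕ) (M : ℝ) (k : ℕ) : Set (HX n) := {x | (M ^ k)⁻¹ ≤ knorm n x ∧ knorm n x < M ^ k}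

lemma mem_ann (n : ℕ) (M : ℝ) (k : ℕ) (x : HX n) :
    x ∈ ann n M k ↔ (M ^ k)⁻¹ ≤ knorm n x ∧ knorm n x < M ^ k := Iff.rfl

lemma measurableSet_ann (n : ℕ) (M : ℝ) (k : ℕ) : MeasurableSet (ann n M k) :=
  (measurableSet_le measurable_const (measurable_knorm n)).inter
    (measurableSet_lt (measurable_knorm n) measurable_const)

lemma ann_pos (n : ℕ) (M : ℝ) (hM : 1 < M) (k : ℕ) (x : HX n) (hx : x ∈ ann n M k) :
    0 < knorm n x := by
  have : 0 < (M ^ k)⁻¹ := by positivity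
  exact this.trans_le hx.1

/-- truncated weight -/
def tw (n : ℕ) (b M : ℝ) (k : ℕ) (x : HX n) : ℝ≥0∞ :=
  (ann n M k).indicator (fun x => ENNReal.ofReal (knorm n x ^ b)) x

lemma measurable_tw (n : ℕ) (b M : ℝ) (k : ℕ) : Measurable (tw n b M k) :=
  (((measurable_knorm n).pow_const b).ennreal_ofReal).indicator (measurableSet_ann n M k)

/-- test function -/
def tf (n : ℕ) (e M : ℝ) (k : ℕ) (x : HX n) : ℝ :=
  (ann n M k).indicator (fun x => knorm n x ^ e) x

lemma measurable_tf (n : ℕ) (b M : ℝ) (k : ℕ) : Measurable (tf n b M k) :=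
  ((measurable_knorm n).pow_const b).indicator (measurableSet_ann n M k)

lemma tf_nonneg (n : ℕ) (e M : ℝ) (k : ℕ) (x : HX n) : 0 ≤ tf n e M k x :=
  Set.indicator_nonneg (fun x _ => Real.rpow_nonneg (knorm_nonneg n x) _) x

lemma tf_le (n : ℕ) (e M : ℝ) (k : ℕ) (x : HX n) : tf n e M k x ≤ knorm n x ^ e :=
  Set.indicator_le_self' (fun x _ => Real.rpow_nonneg (knorm_nonneg n x) _) x

lemma tf_radial (n : ℕ) (e M : ℝ) (k : ℕ) (x y : HX n) (h : knorm n x = knorm n y) :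
    tf n e M k x = tf n e M k y := by
  unfold tf
  have hxy : x ∈ ann n M k ↔ y ∈ ann n M k := by rw [mem_ann, mem_ann, h]
  by_cases hx : x ∈ ann n M k
  · rw [Set.indicator_of_mem hx, Set.indicator_of_mem (hxy.1 hx), h]
  · rw [Set.indicator_of_notMem hx, Set.indicator_of_notMem (fun hy => hx (hxy.2 hy))]

/-- the extremal quantity -/
def Phi (n : ℕ) (s al b M : ℝ) (k : ℕ) : ℝ≥0∞ :=
  ⨆ (a : HX n) (R : ℝ) (_ : 0 < R), wB n al a R ^ (-s) * ∫⁻ x in hball n a R, tw n b M k x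

lemma le_Phi (n : ℕ) (s al b M : ℝ) (k : ℕ) (a : HX n) (R : ℝ) (hR : 0 < R) :
    wB n al a R ^ (-s) * ∫⁻ x in hball n a R, tw n b M k x ≤ Phi n s al b M k :=
  le_iSup_of_le a (le_iSup_of_le R (le_iSup_of_le hR le_rfl))

lemma morrey_tf (n : ℕ) (p l al g e b s M : ℝ) (hM : 1 < M) (k : ℕ) (hp : 0 < p)
    (hs : s = p * l + 1) (hb : b = e * p + g) :
    morreyNorm n p l al g (tf n e M k) ≤ Phi n s al b M k ^ (1/p) := by
  unfold morreyNorm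
  refine iSup_le fun a => iSup_le fun R => iSup_le fun hR => ?_
  change wB n al a R ^ (-(l + 1/p)) * _ ≤ _
  have h1 : ∀ x, ENNReal.ofReal (|tf n e M k x| ^ p * knorm n x ^ g) = tw n b M k x := by
    intro x
    unfold tf tw
    by_cases hx : x ∈ ann n M k
    · have := ann_pos n M hM k x hx
      rw [Set.indicator_of_mem hx, Set.indicator_of_mem hx, abs_of_nonneg (by positivity),
        ← Real.rpow_mul this.le, ← Real.rpow_add this, hb]
    · rw [Set.indicator_of_notMem hx, Set.indicator_of_notMem hx]
      simp [Real.zero_rpow hp.ne']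
  simp only [h1]
  have hp' : 0 ≤ 1/p := by positivity
  refine le_trans (le_of_eq ?_) (ENNReal.rpow_le_rpow (le_Phi n s al b M k a R hR) hp')
  rw [ENNReal.mul_rpow_of_nonneg _ _ hp', ← ENNReal.rpow_mul]
  congr 2
  rw [hs]; field_simp

lemma Phi_le (n : ℕ) (s al b M : ℝ) (hM : 1 < M) (k : ℕ) (hs0 : 0 < s) (hs1 : s < 1)
    (hb : b = Qr n * (s - 1) + al * s) :
    Phi n s al b M k ≤ (∫⁻ x, tw n (-Qr n) M k x) ^ (1 - s) := by
  unfold Phi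
  refine iSup_le fun a => iSup_le fun R => iSup_le fun hR => ?_
  have h1 : ∀ x, tw n b M k x = (ENNReal.ofReal (knorm n x ^ al)) ^ s *
      (tw n (-Qr n) M k x) ^ (1 - s) := by
    intro x
    unfold tw
    by_cases hx : x ∈ ann n M k
    · have := ann_pos n M hM k x hx
      rw [Set.indicator_of_mem hx, Set.indicator_of_mem hx,
        ENNReal.ofReal_rpow_of_pos (by positivity), ENNReal.ofReal_rpow_of_pos (by positivity),
        ← ENNReal.ofReal_mul (by positivity), ← Real.rpow_mul this.le, ← Real.rpow_mul this.le,
        ← Real.rpow_add this, hb]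
      congr 2; ring
    · rw [Set.indicator_of_notMem hx, Set.indicator_of_notMem hx,
        ENNReal.zero_rpow_of_pos (by linarith), mul_zero]
  simp only [h1]
  have h2 := ENNReal.lintegral_mul_norm_pow_le (μ := volume.restrict (hball n a R))
    (f := fun x => ENNReal.ofReal (knorm n x ^ al)) (g := tw n (-Qr n) M k)
    ((measurable_knorm n).pow_const al).ennreal_ofReal.aemeasurable
    (measurable_tw n _ M k).aemeasurable hs0.le (by linarith : 0 ≤ 1 - s) (by ring)
  have h3 : ∫⁻ x in hball n a R, tw n (-Qr n) M k x ≤ ∫⁻ x, tw n (-Qr n) M k x :=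
    setLIntegral_le_lintegral _ _
  have h4 : wB n al a R ^ (-s) * wB n al a R ^ s ≤ 1 := by
    rw [ENNReal.rpow_neg]
    exact ENNReal.inv_mul_le_one _
  calc _ ≤ wB n al a R ^ (-s) * (wB n al a R ^ s *
        (∫⁻ x in hball n a R, tw n (-Qr n) M k x) ^ (1 - s)) := by
        gcongr; exact h2
    _ = (wB n al a R ^ (-s) * wB n al a R ^ s) *
        (∫⁻ x in hball n a R, tw n (-Qr n) M k x) ^ (1 - s) := by ring
    _ ≤ 1 * (∫⁻ x, tw n (-Qr n) M k x) ^ (1 - s) := by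
        gcongr
    _ = _ := one_mul _

lemma finite_of_bdd (n : ℕ) (al c r : ℝ) (hc : 0 < c) (S : Set (HX n))
    (h1 : ∀ x ∈ S, c ≤ knorm n x) (h2 : ∀ x ∈ S, ∀ i, |x i| ≤ r) :
    ∫⁻ x in S, ENNReal.ofReal (knorm n x ^ al) < ⊤ := by
  set K : Set (HX n) := Set.pi Set.univ (fun _ => Set.Icc (-r) r) ∩ {x | c ≤ knorm n x} with hK
  have hKc : IsCompact K := by
    refine IsCompact.inter_right (isCompact_univ_pi fun _ => isCompact_Icc) ?_
    exact isClosed_le continuous_const (continuous_knorm n)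
  have hSK : S ⊆ K := by
    intro x hx
    exact ⟨fun i _ => abs_le.1 (h2 x hx i), h1 x hx⟩
  have hco : ContinuousOn (fun x : HX n => knorm n x ^ al) K := by
    refine (continuous_knorm n).continuousOn.rpow_const fun x hx => Or.inl ?_
    exact (hc.trans_le hx.2).ne'
  have hi := hco.integrableOn_compact hKc (μ := volume)
  exact (lintegral_mono_set hSK).trans_lt hi.lintegral_lt_top

lemma shell (n : ℕ) (M r : ℝ) (hr : 0 < r) :
    ∫⁻ x in {x : HX n | r ≤ knorm n x ∧ knorm n x < r * M}, ENNReal.ofReal (knorm n x ^ (-Qr n)) =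
    ∫⁻ x in {x : HX n | 1 ≤ knorm n x ∧ knorm n x < M}, ENNReal.ofReal (knorm n x ^ (-Qr n)) := by
  have hm : ∀ a b : ℝ, MeasurableSet {x : HX n | a ≤ knorm n x ∧ knorm n x < b} := fun a b =>
    (measurableSet_le measurable_const (measurable_knorm n)).inter
      (measurableSet_lt (measurable_knorm n) measurable_const)
  rw [← lintegral_indicator (hm _ _), ← lintegral_indicator (hm _ _)]
  have h := lintegral_hdil n r hr ({x : HX n | r ≤ knorm n x ∧ knorm n x < r * M}.indicator
    fun x => ENNReal.ofReal (knorm n x ^ (-Qr n)))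
  have h1 : ∀ x : HX n, {x : HX n | r ≤ knorm n x ∧ knorm n x < r * M}.indicator
    (fun x => ENNReal.ofReal (knorm n x ^ (-Qr n))) (hdil n r x) =
    ENNReal.ofReal (r ^ Qr n)⁻¹ * {x : HX n | 1 ≤ knorm n x ∧ knorm n x < M}.indicator
    (fun x => ENNReal.ofReal (knorm n x ^ (-Qr n))) x := by
    intro x
    simp only [Set.indicator_apply, Set.mem_ofPred_eq, knorm_hdil n r hr.le,
      le_mul_iff_one_le_right hr, mul_lt_mul_iff_right₀ hr]
    split_ifs
    · rw [← ENNReal.ofReal_mul (by positivity), Real.mul_rpow hr.le (knorm_nonneg _ _),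
        Real.rpow_neg hr.le]
    · simp
  simp only [h1] at h
  rw [lintegral_const_mul' _ _ ENNReal.ofReal_ne_top] at h
  refine ((ENNReal.mul_right_inj ?_ ENNReal.ofReal_ne_top).1 h).symm
  rw [Ne, ENNReal.ofReal_eq_zero, not_le]; positivity

lemma tw_growth (n : ℕ) (M : ℝ) (hM : 1 < M) : ∃ c : ℝ≥0∞, c < ⊤ ∧
    ∀ k : ℕ, ∫⁻ x, tw n (-Qr n) M k x ≤ k * c := by
  set c0 := ∫⁻ x in {x : HX n | 1 ≤ knorm n x ∧ knorm n x < M},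
    ENNReal.ofReal (knorm n x ^ (-Qr n)) with hc0
  have hfin : c0 < ⊤ := by
    refine finite_of_bdd n _ 1 (M ^ 2) one_pos _ (fun x hx => hx.1) ?_
    intro x hx i
    have hx2 : knorm n x < M := hx.2
    have h0 := knorm_nonneg n x
    refine Fin.lastCases ?_ (fun j => ?_) i
    · have := abs_last_le_knorm n x
      nlinarith
    · have := abs_le_knorm n x j
      nlinarith
  refine ⟨2 * c0, ENNReal.mul_lt_top (by simp) hfin, fun k => ?_⟩
  have hm : ∀ a b : ℝ, MeasurableSet {x : HX n | a ≤ knorm n x ∧ knorm n x < b} := fun a b =>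
    (measurableSet_le measurable_const (measurable_knorm n)).inter
      (measurableSet_lt (measurable_knorm n) measurable_const)
  have hM0 : 0 < M := by linarith
  induction k with
  | zero =>
    have : ∀ x : HX n, tw n (-Qr n) M 0 x = 0 := by
      intro x
      unfold tw
      refine Set.indicator_of_notMem ?_ _
      rw [mem_ann]; simp
    simp [this]
  | succ k ih =>
    have hMk : 0 < M ^ k := by positivity
    have h1 : ∀ x : HX n, tw n (-Qr n) M (k+1) x ≤ tw n (-Qr n) M k x +
      ({x : HX n | (M ^ (k+1))⁻¹ ≤ knorm n x ∧ knorm n x < (M ^ (k+1))⁻¹ * M}.indicator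
        (fun x => ENNReal.ofReal (knorm n x ^ (-Qr n))) x +
      {x : HX n | M ^ k ≤ knorm n x ∧ knorm n x < M ^ k * M}.indicator
        (fun x => ENNReal.ofReal (knorm n x ^ (-Qr n))) x) := by
      intro x
      unfold tw
      by_cases hx : x ∈ ann n M (k+1)
      · rw [Set.indicator_of_mem hx]
        rw [mem_ann] at hx
        by_cases c1 : x ∈ ann n M k
        · rw [Set.indicator_of_mem c1]; exact le_self_add
        rw [mem_ann] at c1
        by_cases c2 : M ^ k ≤ knorm n x
        · have : x ∈ {x : HX n | M ^ k ≤ knorm n x ∧ knorm n x < M ^ k * M} :=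
            ⟨c2, by rw [← pow_succ]; exact hx.2⟩
          rw [Set.indicator_of_mem this]
          exact le_add_self.trans le_add_self
        · have : x ∈ {x : HX n | (M ^ (k+1))⁻¹ ≤ knorm n x ∧ knorm n x < (M ^ (k+1))⁻¹ * M} := by
            refine ⟨hx.1, ?_⟩
            have e1 : (M ^ (k+1))⁻¹ * M = (M ^ k)⁻¹ := by rw [pow_succ]; field_simp
            rw [e1]
            by_contra hcon
            exact c1 ⟨not_lt.1 hcon, not_le.1 c2⟩
          rw [Set.indicator_of_mem this]
          exact le_self_add.trans le_add_self
      · rw [Set.indicator_of_notMem hx]; exact zero_le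
    calc _ ≤ _ := lintegral_mono h1
      _ = (∫⁻ x, tw n (-Qr n) M k x) + (c0 + c0) := by
        rw [lintegral_add_left (measurable_tw n _ M k), lintegral_add_left
          ((((measurable_knorm n).pow_const _).ennreal_ofReal).indicator (hm _ _)),
          lintegral_indicator (hm _ _), lintegral_indicator (hm _ _), shell n M _ (by positivity),
          shell n M _ hMk]
      _ ≤ k * (2 * c0) + (c0 + c0) := by gcongr
      _ = _ := by push_cast; ring

lemma exists_ball (n : ℕ) (hn : 1 ≤ n) (al : ℝ) : ∃ (a : HX n) (R : ℝ), 0 < R ∧ knorm n a = 1 ∧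
    wB n al a R < ⊤ := by
  set i0 : Fin (2*n) := ⟨0, by omega⟩ with hi0
  set a : HX n := Pi.single i0.castSucc 1 with ha
  refine ⟨a, 1/2, by norm_num, ?_, ?_⟩
  · have h := knorm_pow4 n a
    have h1 : ∑ i : Fin (2*n), a (Fin.castSucc i) ^ 2 = 1 := by
      rw [Finset.sum_eq_single i0]
      · simp [ha]
      · intro j _ hj
        have : j.castSucc ≠ i0.castSucc := fun h => hj (Fin.castSucc_injective _ h)
        simp [ha, Pi.single_eq_of_ne this]
      · simp
    have h2 : a (Fin.last (2*n)) = 0 := by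
      have : Fin.last (2*n) ≠ i0.castSucc := (Fin.castSucc_lt_last i0).ne'
      simp [ha, Pi.single_eq_of_ne this]
    rw [h1, h2] at h
    norm_num at h
    exact (pow_eq_one_iff_of_nonneg (knorm_nonneg _ _) (by norm_num)).1 h
  · unfold wB
    have hcoord : ∀ y ∈ hball n a (1/2), ∀ i : Fin (2*n), |a i.castSucc - y i.castSucc| < 1/2 := by
      intro y hy i
      have h1 := abs_le_knorm n (hmul n (fun i => - y i) a) i
      have h2 : hmul n (fun i => - y i) a i.castSucc = a i.castSucc - y i.castSucc := by
        unfold hmul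
        simp; ring
      rw [h2] at h1
      exact h1.trans_lt hy
    have ha1 : ∀ i, |a i| ≤ 1 := by
      intro i
      by_cases h : i = i0.castSucc
      · rw [h]; simp [ha]
      · simp [ha, Pi.single_eq_of_ne h]
    have hy2 : ∀ y ∈ hball n a (1/2), ∀ i : Fin (2*n), |y i.castSucc| ≤ 2 := by
      intro y hy i
      have h1 := abs_lt.1 (hcoord y hy i)
      have h2 := abs_le.1 (ha1 i.castSucc)
      rw [abs_le]; constructor <;> linarith [h1.1, h1.2, h2.1, h2.2]
    refine finite_of_bdd n al (1/2) (2 + 8 * n) (by norm_num) _ ?_ ?_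
    · intro y hy
      have h1 := abs_lt.1 (hcoord y hy i0)
      have h2 : a i0.castSucc = 1 := by simp [ha]
      rw [h2] at h1
      have h3 := abs_le_knorm n y i0
      have h4 := le_abs_self (y i0.castSucc)
      linarith [h1.1, h1.2]
    · intro y hy i
      refine Fin.lastCases ?_ (fun j => ?_) i
      · have h1 := abs_last_le_knorm n (hmul n (fun i => - y i) a)
        have hy' : knorm n (hmul n (fun i => - y i) a) < 1/2 := hy
        have h0 := knorm_nonneg n (hmul n (fun i => - y i) a)
        have h2 : |hmul n (fun i => - y i) a (Fin.last (2*n))| ≤ 1 := by nlinarith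
        unfold hmul at h2
        simp only [Fin.val_last, lt_irrefl, if_false] at h2
        set S := ∑ j : Fin n, (a ⟨j, by have := j.isLt; omega⟩ * -y ⟨n + j, by have := j.isLt; omega⟩
          - -y ⟨j, by have := j.isLt; omega⟩ * a ⟨n + j, by have := j.isLt; omega⟩) with hS
        have hSb : |S| ≤ 4 * n := by
          refine (Finset.abs_sum_le_sum_abs _ _).trans ?_
          have : ∀ j ∈ (Finset.univ : Finset (Fin n)),
            |a ⟨j, by have := j.isLt; omega⟩ * -y ⟨n + j, by have := j.isLt; omega⟩
          - -y ⟨j, by have := j.isLt; omega⟩ * a ⟨n + j, by have := j.isLt; omega⟩| ≤ (4 : ℝ) := by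
            intro j _
            have q1 := ha1 ⟨j, by have := j.isLt; omega⟩
            have q2 := ha1 ⟨n + j, by have := j.isLt; omega⟩
            have q3 := hy2 y hy ⟨j, by have := j.isLt; omega⟩
            have q4 := hy2 y hy ⟨n + j, by have := j.isLt; omega⟩
            simp only [Fin.castSucc_mk] at q3 q4
            refine (abs_sub _ _).trans ?_
            rw [abs_mul, abs_mul, abs_neg, abs_neg]
            nlinarith [mul_le_mul q1 q4 (abs_nonneg _) zero_le_one,
              mul_le_mul q3 q2 (abs_nonneg _) zero_le_two]
          refine (Finset.sum_le_sum this).trans ?_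
          simp; linarith
        have h3 : a (Fin.last (2*n)) = 0 := by
          have : Fin.last (2*n) ≠ i0.castSucc := (Fin.castSucc_lt_last i0).ne'
          simp [ha, Pi.single_eq_of_ne this]
        rw [h3] at h2
        have h4 := abs_le.1 h2
        have h5 := abs_le.1 hSb
        rw [abs_le]; constructor <;> linarith [h4.1, h4.2, h5.1, h5.2]
      · have := hy2 y hy j
        have : (0:ℝ) ≤ n := by positivity
        linarith

lemma Phi_pos (n : ℕ) (hn : 1 ≤ n) (s al b M : ℝ) (hs : 0 < s) (hM : 1 < M) :
    0 < Phi n s al b M 1 := by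
  obtain ⟨a, R, hR, ha, hw⟩ := exists_ball n hn al
  refine lt_of_lt_of_le ?_ (le_Phi n s al b M 1 a R hR)
  refine ENNReal.mul_pos ?_ ?_
  · rw [Ne, ENNReal.rpow_eq_zero_iff]
    rintro (⟨-, h⟩ | ⟨h, -⟩)
    · linarith
    · exact hw.ne h
  · intro h
    rw [lintegral_eq_zero_iff (measurable_tw n b M 1)] at h
    set U : Set (HX n) := hball n a R ∩ {x | M⁻¹ < knorm n x ∧ knorm n x < M} with hU
    have hUo : IsOpen U := (isOpen_hball n a R).inter
      ((isOpen_lt continuous_const (continuous_knorm n)).inter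
        (isOpen_lt (continuous_knorm n) continuous_const))
    have haU : a ∈ U := by
      refine ⟨?_, ?_, ?_⟩
      · change knorm n (hmul n (fun i => - a i) a) < R
        have : hmul n (fun i => - a i) a = 0 := by
          funext i
          unfold hmul
          have : ∀ u v : ℝ, u * -v - -u * v = 0 := fun u v => by ring
          simp [this]
        rw [this]
        have : knorm n 0 = 0 := by
          have h := knorm_pow4 n 0
          simpa using h
        rw [this]; exact hR
      · rw [ha]; exact inv_lt_one_of_one_lt₀ hM
      · rw [ha]; exact hM
    have hpos := hUo.measure_pos volume ⟨a, haU⟩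
    have h2 : (volume.restrict (hball n a R)) U = 0 := by
      refine measure_mono_null ?_ h
      intro x hx hx0
      have hxa : x ∈ ann n M 1 := by
        rw [mem_ann, pow_one]; exact ⟨hx.2.1.le, hx.2.2⟩
      have := ann_pos n M hM 1 x hxa
      have hx0 : tw n b M 1 x = 0 := hx0
      rw [tw, Set.indicator_of_mem hxa, ENNReal.ofReal_eq_zero] at hx0
      have : 0 < knorm n x ^ b := by positivity
      linarith
    rw [Measure.restrict_apply hUo.measurableSet, Set.inter_eq_left.2 Set.inter_subset_left] at h2
    exact hpos.ne' h2

/-- truncation region for the constant -/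
def SM (n m : ℕ) (M : ℝ) : Set (Fin m → HX n) := {z | ∀ j, M⁻¹ ≤ knorm n (z j) ∧ knorm n (z j) < M}

lemma measurableSet_SM (n m : ℕ) (M : ℝ) : MeasurableSet (SM n m M) := by
  have : SM n m M = ⋂ j, {z : Fin m → HX n | M⁻¹ ≤ knorm n (z j) ∧ knorm n (z j) < M} := by
    ext z; simp [SM]
  rw [this]
  refine MeasurableSet.iInter fun j => ?_
  have h := (measurable_knorm n).comp (measurable_pi_apply (X := fun _ : Fin m => HX n) j)
  exact (measurableSet_le measurable_const h).inter (measurableSet_lt h measurable_const)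

/-- truncated constant -/
def BM (n m : ℕ) (e : Fin m → ℝ) (M : ℝ) : ℝ≥0∞ :=
  ∫⁻ y in SM n m M, ENNReal.ofReal ((∏ j, knorm n (y j) ^ e j) /
      (1 + ∑ j, knorm n (y j) ^ Qr n) ^ m)

lemma BM_le (n m : ℕ) (e : Fin m → ℝ) (M : ℝ) : BM n m e M ≤ Bconst n m e :=
  setLIntegral_le_lintegral _ _

lemma Bconst_eq (n m : ℕ) (e : Fin m → ℝ) :
    Bconst n m e = ⨆ i : ℕ, BM n m e ((i : ℝ) + 2) := by
  have hd : Directed (fun x1 x2 : Set (Fin m → HX n) => x1 ⊆ x2)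
      (fun i : ℕ => SM n m ((i : ℝ) + 2)) := by
    refine Monotone.directed_le (f := fun i : ℕ => SM n m ((i : ℝ) + 2)) ?_
    intro i j hij z hz l
    have h : (i : ℝ) ≤ j := by exact_mod_cast hij
    have h0 : (0 : ℝ) ≤ i := by positivity
    refine ⟨le_trans ?_ (hz l).1, lt_of_lt_of_le (hz l).2 (by linarith)⟩
    exact inv_anti₀ (by linarith) (by linarith)
  unfold BM
  rw [← setLIntegral_iUnion_of_directed _ hd]
  unfold Bconst
  have hu : ∀ᵐ z : Fin m → HX n, z ∈ ⋃ i : ℕ, SM n m ((i : ℝ) + 2) := by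
    filter_upwards [ae_pi_pos n m] with z hz
    obtain ⟨N, hN⟩ := exists_nat_gt (∑ j, (knorm n (z j) + (knorm n (z j))⁻¹))
    refine Set.mem_iUnion.2 ⟨N, fun j => ?_⟩
    have h1 : knorm n (z j) + (knorm n (z j))⁻¹ ≤ ∑ j, (knorm n (z j) + (knorm n (z j))⁻¹) :=
      Finset.single_le_sum (f := fun j => knorm n (z j) + (knorm n (z j))⁻¹)
        (fun j _ => by have := hz j; positivity) (Finset.mem_univ j)
    have h2 := hz j
    have h3 : 0 < (knorm n (z j))⁻¹ := by positivity
    refine ⟨?_, by linarith⟩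
    rw [inv_le_comm₀ (by positivity) h2]
    linarith
  rw [← lintegral_indicator (MeasurableSet.iUnion fun i => measurableSet_SM n m _)]
  refine lintegral_congr_ae ?_
  filter_upwards [hu] with z hz
  rw [Set.indicator_of_mem hz]

lemma hilb_lower (n m : ℕ) (e : Fin m → ℝ) (M : ℝ) (hM : 1 < M) (k : ℕ)
    (hB : Bconst n m e < ⊤) (x : HX n) (hx : x ∈ ann n M k) :
    ENNReal.ofReal (knorm n x ^ (∑ j, e j)) * BM n m e M ≤
      ENNReal.ofReal (hilbOp n m (fun j => tf n (e j) M (k+1)) x) := by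
  have hx0 := ann_pos n M hM k x hx
  have hM0 : 0 < M := by linarith
  set r := knorm n x with hr
  have hmeas : Measurable (fun y : Fin m → HX n => (∏ j, tf n (e j) M (k+1) (y j)) /
        (r ^ Qr n + ∑ j, knorm n (y j) ^ Qr n) ^ m) :=
    (Finset.measurable_prod _ fun j _ =>
      (measurable_tf n _ M (k+1)).comp (measurable_pi_apply j)).div (measurable_den n m _)
  have hnn : ∀ y : Fin m → HX n, 0 ≤ (∏ j, tf n (e j) M (k+1) (y j)) /
        (r ^ Qr n + ∑ j, knorm n (y j) ^ Qr n) ^ m := by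
    intro y
    have h1 : 0 ≤ ∑ j, knorm n (y j) ^ Qr n :=
      Finset.sum_nonneg fun j _ => Real.rpow_nonneg (knorm_nonneg _ _) _
    exact div_nonneg (Finset.prod_nonneg fun j _ => tf_nonneg n _ _ _ _)
      (pow_nonneg (add_nonneg (by positivity) h1) m)
  have hscale : ∀ z : Fin m → HX n, ∏ j, knorm n (hdil n r (z j)) ^ e j =
      r ^ (∑ j, e j) * ∏ j, knorm n (z j) ^ e j := by
    intro z
    rw [Real.rpow_sum_of_pos hx0, ← Finset.prod_mul_distrib]
    refine Finset.prod_congr rfl fun j _ => ?_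
    rw [knorm_hdil n r hx0.le, Real.mul_rpow hx0.le (knorm_nonneg _ _)]
  have hc := cov n m r hx0 (fun j => tf n (e j) M (k+1))
  have hup : ∫⁻ y : Fin m → HX n, ENNReal.ofReal ((∏ j, tf n (e j) M (k+1) (y j)) /
        (r ^ Qr n + ∑ j, knorm n (y j) ^ Qr n) ^ m) < ⊤ := by
    rw [hc]
    refine lt_of_le_of_lt (b := ENNReal.ofReal (r ^ (∑ j, e j)) * Bconst n m e) ?_
      (ENNReal.mul_lt_top ENNReal.ofReal_lt_top hB)
    unfold Bconst
    rw [← lintegral_const_mul' _ _ ENNReal.ofReal_ne_top]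
    refine lintegral_mono fun z => ?_
    rw [← ENNReal.ofReal_mul (by positivity), ← mul_div_assoc, ← hscale]
    refine ENNReal.ofReal_le_ofReal (div_le_div_of_nonneg_right ?_ (den_pos n m z).le)
    exact Finset.prod_le_prod (fun j _ => tf_nonneg n _ _ _ _) (fun j _ => tf_le n _ _ _ _)
  have hI : Integrable (fun y : Fin m → HX n => (∏ j, tf n (e j) M (k+1) (y j)) /
        (r ^ Qr n + ∑ j, knorm n (y j) ^ Qr n) ^ m) := by
    refine ⟨hmeas.aestronglyMeasurable, ?_⟩
    rw [hasFiniteIntegral_iff_ofReal (Filter.Eventually.of_forall hnn)]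
    exact hup
  unfold hilbOp
  rw [ofReal_integral_eq_lintegral_ofReal hI (Filter.Eventually.of_forall hnn), hc]
  unfold BM
  rw [← lintegral_const_mul' _ _ ENNReal.ofReal_ne_top,
    ← lintegral_indicator (measurableSet_SM n m M)]
  refine lintegral_mono fun z => ?_
  by_cases hz : z ∈ SM n m M
  · rw [Set.indicator_of_mem hz, ← ENNReal.ofReal_mul (by positivity), ← mul_div_assoc, ← hscale]
    refine ENNReal.ofReal_le_ofReal (div_le_div_of_nonneg_right (le_of_eq ?_) (den_pos n m z).le)
    refine Finset.prod_congr rfl fun j _ => ?_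
    unfold tf
    rw [Set.indicator_of_mem]
    rw [mem_ann, knorm_hdil n r hx0.le, pow_succ, mul_inv]
    obtain ⟨z1, z2⟩ := hz j
    obtain ⟨x1, x2⟩ := hx
    constructor
    · exact mul_le_mul x1 z1 (by positivity) hx0.le
    · exact mul_lt_mul'' x2 z2 hx0.le (knorm_nonneg _ _)
  · rw [Set.indicator_of_notMem hz]; exact zero_le

lemma Phi_step (n m : ℕ) (e : Fin m → ℝ) (M : ℝ) (hM : 1 < M) (k : ℕ)
    (hB : Bconst n m e < ⊤) (q lam al ga b s : ℝ) (hq : 0 < q) (hs : s = q * lam + 1)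
    (hb : b = (∑ j, e j) * q + ga) :
    BM n m e M ^ q * Phi n s al b M k ≤
      morreyNorm n q lam al ga (hilbOp n m (fun j => tf n (e j) M (k+1))) ^ q := by
  have hBT : BM n m e M ^ q ≠ ⊤ :=
    ENNReal.rpow_ne_top_of_nonneg hq.le ((BM_le n m e M).trans_lt hB).ne
  unfold Phi
  simp only [ENNReal.mul_iSup]
  refine iSup_le fun a => iSup_le fun R => iSup_le fun hR => ?_
  refine le_trans ?_ (ENNReal.rpow_le_rpow (le_morreyNorm n q lam al ga
    (hilbOp n m (fun j => tf n (e j) M (k+1))) a R hR) hq.le)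
  rw [ENNReal.mul_rpow_of_nonneg _ _ hq.le, ← ENNReal.rpow_mul, ← ENNReal.rpow_mul,
    one_div_mul_cancel hq.ne', ENNReal.rpow_one]
  have h1 : -(lam + 1/q) * q = -s := by rw [hs]; field_simp
  rw [h1, mul_left_comm, ← lintegral_const_mul' _ _ hBT]
  refine mul_le_mul' le_rfl (lintegral_mono fun x => ?_)
  unfold tw
  by_cases hx : x ∈ ann n M k
  · have hx0 := ann_pos n M hM k x hx
    have h2 := ENNReal.rpow_le_rpow (hilb_lower n m e M hM k hB x hx) hq.le
    have h3 := hilbOp_nonneg n m (fun j => tf n (e j) M (k+1)) (fun j x => tf_nonneg n _ _ _ x) x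
    rw [Set.indicator_of_mem hx, abs_of_nonneg h3, ENNReal.ofReal_mul (by positivity),
      ← ENNReal.ofReal_rpow_of_nonneg h3 hq.le, hb, Real.rpow_add hx0,
      ENNReal.ofReal_mul (by positivity), Real.rpow_mul hx0.le,
      ← ENNReal.ofReal_rpow_of_nonneg (by positivity) hq.le, ← mul_assoc, mul_comm (BM n m e M ^ q),
      ← ENNReal.mul_rpow_of_nonneg _ _ hq.le]
    exact mul_le_mul' h2 le_rfl
  · rw [Set.indicator_of_notMem hx, mul_zero]; exact zero_le

/-- geometric growth beats linear growth -/
lemma growth (β γ : ℝ≥0∞) (Φ : ℕ → ℝ≥0∞) (hβ : β ≠ ⊤) (h1 : 0 < Φ 1) (c : ℝ≥0∞) (hc : c < ⊤)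
    (hΦ : ∀ k, Φ k ≤ 1 + k * c) (hstep : ∀ k, β * Φ k ≤ γ * Φ (k+1)) : β ≤ γ := by
  by_contra hcon
  push Not at hcon
  have hγ : γ ≠ ⊤ := hcon.ne_top
  have hit : ∀ k : ℕ, β ^ k * Φ 1 ≤ γ ^ k * Φ (k+1) := by
    intro k
    induction k with
    | zero => simp
    | succ k ih =>
      calc β ^ (k+1) * Φ 1 = β * (β ^ k * Φ 1) := by ring
        _ ≤ β * (γ ^ k * Φ (k+1)) := by gcongr
        _ = γ ^ k * (β * Φ (k+1)) := by ring
        _ ≤ γ ^ k * (γ * Φ (k+1+1)) := mul_le_mul' le_rfl (hstep _)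
        _ = _ := by ring
  have hΦ1 : Φ 1 ≠ ⊤ := by
    refine ((hΦ 1).trans_lt ?_).ne
    simpa using hc
  lift β to NNReal using hβ
  lift γ to NNReal using hγ
  lift c to NNReal using hc.ne
  obtain ⟨φ, hφ⟩ : ∃ φ : NNReal, (φ : ℝ≥0∞) = Φ 1 := ⟨(Φ 1).toNNReal, ENNReal.coe_toNNReal hΦ1⟩
  rw [← hφ] at hit h1
  have hr : ∀ k : ℕ, (β : ℝ) ^ k * φ ≤ γ ^ k * (1 + (k + 1) * c) := by
    intro k
    have h2 : (β : ℝ≥0∞) ^ k * φ ≤ γ ^ k * (1 + (k + 1 : ℕ) * c) := (hit k).trans (by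
      gcongr; exact hΦ (k+1))
    have h3 : β ^ k * φ ≤ γ ^ k * (1 + (k + 1 : ℕ) * c) := by exact_mod_cast h2
    have h4 : ((β ^ k * φ : NNReal) : ℝ) ≤ ((γ ^ k * (1 + (k + 1 : ℕ) * c) : NNReal) : ℝ) := by
      exact_mod_cast h3
    push_cast at h4
    exact h4
  have hlt : (γ : ℝ) < β := by exact_mod_cast hcon
  have hφ0 : (0 : ℝ) < φ := by exact_mod_cast h1
  have hγ0 : (0 : ℝ) ≤ γ := γ.2
  have hβ0 : (0 : ℝ) < β := hγ0.trans_lt hlt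
  set ρ : ℝ := γ / β with hρ
  have hρ0 : 0 ≤ ρ := by positivity
  have hρ1 : ρ < 1 := by rw [hρ, div_lt_one hβ0]; exact hlt
  have t1 := tendsto_pow_atTop_nhds_zero_of_lt_one hρ0 hρ1
  have t2 := tendsto_self_mul_const_pow_of_lt_one hρ0 hρ1
  have t3 : Filter.Tendsto (fun k : ℕ => (1 + c) * ρ ^ k + c * (k * ρ ^ k)) Filter.atTop
      (nhds ((1 + (c:ℝ)) * 0 + c * 0)) := (t1.const_mul _).add (t2.const_mul _)
  have h5 : ∀ k : ℕ, (φ : ℝ) ≤ (1 + c) * ρ ^ k + c * (k * ρ ^ k) := by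
    intro k
    have h6 := hr k
    have h7 : (0 : ℝ) < β ^ k := by positivity
    have h8 : (1 + c) * ρ ^ k + c * (k * ρ ^ k) = (γ ^ k * (1 + (k + 1) * c)) / β ^ k := by
      rw [hρ, div_pow]; field_simp; ring
    rw [h8, le_div_iff₀ h7]
    linarith
  have h9 := ge_of_tendsto' t3 h5
  simp only [mul_zero, add_zero] at h9
  exact absurd hφ0 (not_lt.2 h9)

theorem stmt8 (n : ℕ) (hn : 1 ≤ n) (m : ℕ) (hm : 1 ≤ m)
    (q lam al ga : ℝ) (qj lamj gaj : Fin m → ℝ)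
    (hq : 1 ≤ q) (hlam1 : -(1/q) ≤ lam) (hlam2 : lam < 0)
    (hqj : ∀ j, 1 < qj j)
    (hsum : 1/q = ∑ j, 1/(qj j))
    (hga : ga = ∑ j, gaj j)
    (hal : al ≠ -(Qr n))
    (hlamj1 : ∀ j, -(1/(qj j)) < lamj j) (hlamj2 : ∀ j, lamj j < 0)
    (hql : ∀ j, q * lam = qj j * lamj j)
    (hB : Bconst n m (fun j => Qr n * lamj j - gaj j / q + al * (lamj j + 1/(qj j))) < ⊤) :
    sInf {C : ℝ≥0∞ | ∀ f : Fin m → (Fin (2*n+1) → ℝ) → ℝ,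
        (∀ j x, 0 ≤ f j x) →
        (∀ j x y, knorm n x = knorm n y → f j x = f j y) →
        (∀ j, morreyNorm n (qj j) (lamj j) al (qj j * gaj j / q) (f j) < ⊤) →
        morreyNorm n q lam al ga (hilbOp n m f)
          ≤ C * ∏ j, morreyNorm n (qj j) (lamj j) al (qj j * gaj j / q) (f j)}
      = Bconst n m (fun j => Qr n * lamj j - gaj j / q + al * (lamj j + 1/(qj j))) := by
  have hq0 : 0 < q := by linarith
  have hqj0 : ∀ j, 0 < qj j := fun j => by linarith [hqj j]
  have j0 : Fin m := ⟨0, hm⟩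
  have hs0 : 0 < q * lam + 1 := by
    have h1 := hlamj1 j0
    have h2 := hqj0 j0
    rw [hql j0]
    have h3 := mul_lt_mul_of_pos_left h1 h2
    have h4 : qj j0 * -(1 / qj j0) = -1 := by field_simp
    linarith
  have hs1 : q * lam + 1 < 1 := by nlinarith
  have hlam : 0 < lam + 1/q := by
    have : lam + 1/q = (q * lam + 1) / q := by field_simp
    rw [this]; positivity
  refine le_antisymm (sInf_le ?_) (le_sInf ?_)
  · intro f hf hr _
    exact upper n m q lam al ga qj lamj gaj hq hqj hlam hsum hga hql f hf hr hB
  intro C hC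
  set e : Fin m → ℝ := fun j => Qr n * lamj j - gaj j / q + al * (lamj j + 1/(qj j)) with he
  set s := q * lam + 1 with hs
  set b := Qr n * (s - 1) + al * s with hb
  have hlj : ∀ j, lamj j = q * lam * (1 / qj j) := by
    intro j
    have := hqj0 j
    rw [hql j]; field_simp
  have hbe : b = (∑ j, e j) * q + ga := by
    have h1 : ∀ j, e j = (Qr n * (q * lam) + al * s) * (1 / qj j) - gaj j / q := by
      intro j
      simp only [he]
      rw [hlj j, hs]; ring
    simp only [h1]
    rw [Finset.sum_sub_distrib, ← Finset.mul_sum, ← hsum, ← Finset.sum_div, ← hga, hb, hs]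
    field_simp
    ring
  have hbj : ∀ j, b = e j * qj j + qj j * gaj j / q := by
    intro j
    have := hqj0 j
    simp only [he]
    rw [hlj j, hb, hs]
    field_simp
    ring
  rw [Bconst_eq]
  refine iSup_le fun i => ?_
  have hM : (1 : ℝ) < (i : ℝ) + 2 := by
    have : (0 : ℝ) ≤ i := by positivity
    linarith
  set M : ℝ := (i : ℝ) + 2 with hMdef
  obtain ⟨c, hc, hgr⟩ := tw_growth n M hM
  have hPhi : ∀ k : ℕ, Phi n s al b M k ≤ 1 + k * c := by
    intro k
    refine (Phi_le n s al b M hM k hs0 hs1 rfl).trans ?_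
    refine (ENNReal.rpow_le_rpow (hgr k) (by linarith)).trans ?_
    rcases le_total ((k : ℝ≥0∞) * c) 1 with h | h
    · exact (ENNReal.rpow_le_one h (by linarith)).trans le_self_add
    · calc ((k : ℝ≥0∞) * c) ^ (1 - s) ≤ ((k : ℝ≥0∞) * c) ^ (1 : ℝ) :=
            ENNReal.rpow_le_rpow_of_exponent_le h (by linarith)
        _ = k * c := ENNReal.rpow_one _
        _ ≤ _ := le_add_self
  have hPhiT : ∀ k : ℕ, Phi n s al b M k < ⊤ := fun k =>
    (hPhi k).trans_lt (ENNReal.add_lt_top.2 ⟨ENNReal.one_lt_top,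
      ENNReal.mul_lt_top (ENNReal.natCast_lt_top k) hc⟩)
  have hBT : BM n m e M ^ q ≠ ⊤ :=
    ENNReal.rpow_ne_top_of_nonneg hq0.le ((BM_le n m e M).trans_lt hB).ne
  have hmor : ∀ k j, morreyNorm n (qj j) (lamj j) al (qj j * gaj j / q) (tf n (e j) M k) ≤
      Phi n s al b M k ^ (1 / qj j) := fun k j =>
    morrey_tf n (qj j) (lamj j) al _ (e j) b s M hM k (hqj0 j) (by rw [hs, hql j]) (hbj j)
  have hfinal : BM n m e M ^ q ≤ C ^ q := by
    refine growth _ _ (fun k => Phi n s al b M k) hBT (Phi_pos n hn s al b M hs0 hM) c hc hPhi ?_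
    intro k
    refine (Phi_step n m e M hM k hB q lam al ga b s hq0 hs hbe).trans ?_
    have h1 := hC (fun j => tf n (e j) M (k+1)) (fun j x => tf_nonneg n _ _ _ x)
      (fun j x y h => tf_radial n _ _ _ x y h) (fun j => (hmor (k+1) j).trans_lt
        (ENNReal.rpow_lt_top_of_nonneg (by have := hqj0 j; positivity) (hPhiT (k+1)).ne))
    have h2 : ∏ j, morreyNorm n (qj j) (lamj j) al (qj j * gaj j / q) (tf n (e j) M (k+1)) ≤
        Phi n s al b M (k+1) ^ (1 / q) := by
      refine (Finset.prod_le_prod' fun j _ => hmor (k+1) j).trans (le_of_eq ?_)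
      rw [hsum]
      have key : ∀ S : Finset (Fin m), ∏ j ∈ S, Phi n s al b M (k+1) ^ (1 / qj j) =
          Phi n s al b M (k+1) ^ (∑ j ∈ S, 1 / qj j) := by
        intro S
        induction S using Finset.induction_on with
        | empty => simp
        | insert i S hi ih => rw [Finset.prod_insert hi, Finset.sum_insert hi, ih,
            ENNReal.rpow_add_of_nonneg _ _ (by have := hqj0 i; positivity)
              (Finset.sum_nonneg fun j _ => by have := hqj0 j; positivity)]
      exact key _
    have h3 := ENNReal.rpow_le_rpow (h1.trans (mul_le_mul' le_rfl h2)) hq0.le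
    rw [ENNReal.mul_rpow_of_nonneg _ _ hq0.le, ← ENNReal.rpow_mul, one_div_mul_cancel hq0.ne',
      ENNReal.rpow_one] at h3
    exact h3
  exact (ENNReal.rpow_le_rpow_iff hq0).1 hfinal
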